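/- Let s ∈ (1/2, 1) and let x ∈ (−1,1) be irrational. If Σ_{j=0}^{∞} (Π_{ℓ=0}^{j−1} |T^ℓ(x)|)^{s−1/2} / |T^j(x)|^{(1−s)/2} < ∞ (empty product equal to 1 for j = 0), then the series F_s(x) = Σ_{k=1}^{∞} e^{iπk²x}/k^s converges and F_s(x) = Σ_{j=0}^{∞} e^{(iπ/4) Σ_{ℓ=0}^{j−1} σ(T^ℓ(x))} (Π_{ℓ=0}^{j−1} |T^ℓ(x)|)^{s−1/2} Ω_s(T^j(x)), the series on the right-hand side being absolutely convergent. -/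

import Mathlib

open Complex Filter Finset

noncomputable section

/-- `ρ = e^{iπ/4}`. -/
def ρ : ℂ := Complex.exp (Real.pi * Complex.I / 4)

/-- Partial sum `F_{s,n}(x,t) = Σ_{k=1}^{n} e^{iπk²x + 2πikt}/k^s`. -/
def Fpart (s : ℝ) (n : ℕ) (x t : ℝ) : ℂ :=
  ∑ k ∈ Finset.Icc 1 n,
    Complex.exp (Real.pi * Complex.I * (k : ℂ) ^ 2 * (x : ℂ)
        + 2 * Real.pi * Complex.I * (k : ℂ) * (t : ℂ)) / (k : ℂ) ^ (s : ℂ)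

/-- The function `I_s(x,t)` (for `x > 0`). -/
def Ifun (s x t : ℝ) : ℂ :=
  (∫ u : ℝ, ρ *
      (Complex.exp (Real.pi * Complex.I * ((1 : ℂ) / 2 + ρ * (u : ℂ)) ^ 2 * (x : ℂ)
            + 2 * Real.pi * Complex.I * ((1 : ℂ) / 2 + ρ * (u : ℂ)) * (Int.fract t : ℝ)) /
        (((1 : ℂ) / 2 + ρ * (u : ℂ)) ^ (s : ℂ) *
          (1 - Complex.exp (2 * Real.pi * Complex.I * ((1 : ℂ) / 2 + ρ * (u : ℂ)))))))
  + ρ * (x : ℂ) ^ (s : ℂ) *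
    ∫ u : ℝ, (Real.exp (-(Real.pi * x * u ^ 2)) : ℝ) *
      ∑' k : ℕ, Complex.exp (-(Real.pi * Complex.I * (((k : ℂ) + 1) - (Int.fract t : ℝ)) ^ 2 / (x : ℂ))) *
        (((ρ * (x : ℂ) * (u : ℂ) + ((k : ℂ) + 1) - (Int.fract t : ℝ)) ^ (s : ℂ))⁻¹
          - (((k : ℂ) + 1) ^ (s : ℂ))⁻¹)

/-- `Ω_s(x,t)`. -/
def Omega (s x t : ℝ) : ℂ :=
  if 0 < x then Ifun s x t else (starRingEnd ℂ) (Ifun s (-x) (-t))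

/-- `Ω_s(x) = Ω_s(x,0)`. -/
def Omega0 (s x : ℝ) : ℂ := Omega s x 0

/-- The map `T(x) = -1/x mod 2`, valued in `(-1,1]`. -/
def Tmap (x : ℝ) : ℝ := -1 / x - 2 * ⌈((-1 / x) - 1) / 2⌉

/-- Denominator `Q_n` of the `n`-th convergent of the regular continued fraction of `x`. -/
def Qden (x : ℝ) (n : ℕ) : ℝ := (GenContFract.of x).dens n

end

open scoped Topology

noncomputable section

open MeasureTheory

/-! ### Integrals over the lines `c + ρ u` -/

lemma rho_re : ρ.re = √2 / 2 := by
  have h : (Real.pi * Complex.I / 4 : ℂ) = ((Real.pi / 4 : ℝ) : ℂ) * Complex.I := by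
    push_cast; ring
  rw [ρ, h, Complex.exp_ofReal_mul_I_re, Real.cos_pi_div_four]

lemma rho_im : ρ.im = √2 / 2 := by
  have h : (Real.pi * Complex.I / 4 : ℂ) = ((Real.pi / 4 : ℝ) : ℂ) * Complex.I := by
    push_cast; ring
  rw [ρ, h, Complex.exp_ofReal_mul_I_im, Real.sin_pi_div_four]

lemma half_sqrt_two_sq : (√2 / 2) * (√2 / 2) = 1 / 2 := by
  have := Real.mul_self_sqrt (show (0 : ℝ) ≤ 2 by norm_num)
  linarith

lemma half_sqrt_two_pos : 0 < √2 / 2 := by positivity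

lemma half_sqrt_two_gt : 7 / 10 < √2 / 2 := by
  nlinarith [half_sqrt_two_sq, half_sqrt_two_pos]

lemma half_sqrt_two_lt : √2 / 2 < 3 / 4 := by
  nlinarith [half_sqrt_two_sq, half_sqrt_two_pos]

lemma rho_eq : ρ = ((√2 / 2 : ℝ) : ℂ) * (1 + Complex.I) := by
  apply Complex.ext <;> simp [rho_re, rho_im]

lemma rho_sq : ρ * ρ = Complex.I := by
  have h : (((√2 / 2 : ℝ) : ℂ)) * ((√2 / 2 : ℝ) : ℂ) = 1 / 2 := by
    rw [← Complex.ofReal_mul, half_sqrt_two_sq]; norm_num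
  rw [rho_eq]
  linear_combination (2 * Complex.I + 1 + Complex.I ^ 2) * h + 1 / 2 * Complex.I_sq

lemma norm_rho : ‖ρ‖ = 1 := by
  have h : (Real.pi * Complex.I / 4 : ℂ) = ((Real.pi / 4 : ℝ) : ℂ) * Complex.I := by
    push_cast; ring
  rw [ρ, h, Complex.norm_exp_ofReal_mul_I]

lemma rho_ne_zero : ρ ≠ 0 := Complex.exp_ne_zero _

lemma line_re (c u : ℝ) : ((c : ℂ) + ρ * u).re = c + √2 / 2 * u := by simp [rho_re]

lemma line_im (c u : ℝ) : ((c : ℂ) + ρ * u).im = √2 / 2 * u := by simp [rho_im]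

lemma line_mem_slitPlane {c : ℝ} (hc : 0 < c) (u : ℝ) : (c : ℂ) + ρ * u ∈ Complex.slitPlane := by
  rw [Complex.mem_slitPlane_iff, line_re, line_im]
  rcases eq_or_ne u 0 with rfl | hu
  · left; simpa using hc
  · right; exact mul_ne_zero half_sqrt_two_pos.ne' hu

lemma norm_line_sq (c u : ℝ) :
    (c ^ 2 + u ^ 2) / 4 ≤ ‖(c : ℂ) + ρ * u‖ ^ 2 := by
  rw [Complex.sq_norm, Complex.normSq_apply, line_re, line_im]
  have h1 := half_sqrt_two_sq
  have h2 := half_sqrt_two_lt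
  have h3 := half_sqrt_two_pos
  generalize √2 / 2 = r at *
  have e : (c + r * u) * (c + r * u) + r * u * (r * u) = c ^ 2 + 2 * r * c * u + u ^ 2 := by
    linear_combination (2 * u ^ 2) * h1
  rw [e]
  nlinarith [mul_nonneg h3.le (sq_nonneg (c + u)), mul_nonneg (sub_nonneg.2 h2.le) (sq_nonneg c),
    mul_nonneg (sub_nonneg.2 h2.le) (sq_nonneg u)]

lemma half_le_norm_line {c : ℝ} (u : ℝ) : c / 2 ≤ ‖(c : ℂ) + ρ * u‖ := by
  have := norm_line_sq c u
  refine le_of_sq_le_sq ?_ (norm_nonneg _)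
  nlinarith [sq_nonneg u]

lemma half_abs_le_norm_line (c u : ℝ) : |u| / 2 ≤ ‖(c : ℂ) + ρ * u‖ := by
  have := norm_line_sq c u
  refine le_of_sq_le_sq ?_ (norm_nonneg _)
  rw [div_pow, sq_abs]
  nlinarith [sq_nonneg c]

/-- `φ` decays like a Gaussian on the lines `c + ρ u`, uniformly for `c ∈ [c₁, c₂]`. -/
def GaussDecay (φ : ℂ → ℂ) (c₁ c₂ : ℝ) : Prop :=
  ∃ C ε : ℝ, 0 < ε ∧ ∀ c ∈ Set.Icc c₁ c₂, ∀ u : ℝ, 1 ≤ |u| →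
    ‖φ (c + ρ * u)‖ ≤ C * Real.exp (-ε * u ^ 2)

lemma GaussDecay.integrable {φ : ℂ → ℂ} {c₁ c₂ : ℝ} (h : GaussDecay φ c₁ c₂) {c : ℝ}
    (hc : c ∈ Set.Icc c₁ c₂) (hd : ∀ u : ℝ, DifferentiableAt ℂ φ (c + ρ * u)) :
    Integrable (fun u : ℝ => φ (c + ρ * u)) := by
  obtain ⟨C, ε, hε, hb⟩ := h
  have hcont : Continuous (fun u : ℝ => φ (c + ρ * u)) := by
    rw [continuous_iff_continuousAt]
    intro u
    exact ContinuousAt.comp (f := fun u : ℝ => (c : ℂ) + ρ * u) (hd u).continuousAt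
      (by fun_prop)
  obtain ⟨M, hM⟩ := (isCompact_Icc (a := (-1 : ℝ)) (b := 1)).exists_bound_of_continuousOn
    hcont.continuousOn
  refine Integrable.mono' ((integrable_exp_neg_mul_sq hε).const_mul (|C| + |M| * Real.exp ε))
    hcont.aestronglyMeasurable (Filter.Eventually.of_forall fun u => ?_)
  rcases le_total 1 |u| with hu | hu
  · refine (hb c hc u hu).trans ?_
    gcongr
    have : 0 ≤ |M| * Real.exp ε := by positivity
    linarith [le_abs_self C]
  · refine (hM u (abs_le.1 hu)).trans ?_
    have h1 : u ^ 2 ≤ 1 := by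
      rw [← sq_abs]; exact pow_le_one₀ (abs_nonneg u) hu
    have h2 : 1 ≤ Real.exp ε * Real.exp (-ε * u ^ 2) := by
      rw [← Real.exp_add]; exact Real.one_le_exp (by nlinarith)
    calc M ≤ |M| * 1 := by rw [mul_one]; exact le_abs_self M
      _ ≤ |M| * (Real.exp ε * Real.exp (-ε * u ^ 2)) := by gcongr
      _ ≤ _ := by
        have : 0 ≤ |C| * Real.exp (-ε * u ^ 2) := by positivity
        linarith

lemma line_eq_rho_mul (c u : ℝ) :
    (c : ℂ) + ρ * u = ρ * (((u + √2 / 2 * c : ℝ) : ℂ) + ((-(√2 / 2 * c) : ℝ) : ℂ) * Complex.I) := by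
  have h : (((√2 / 2 : ℝ) : ℂ)) * ((√2 / 2 : ℝ) : ℂ) = 1 / 2 := by
    rw [← Complex.ofReal_mul, half_sqrt_two_sq]; norm_num
  have h2 : ((√2 / 2 : ℝ) : ℂ) * ρ * (1 - Complex.I) = 1 := by
    rw [rho_eq]
    linear_combination (1 - Complex.I ^ 2) * h - 1 / 2 * Complex.I_sq
  push_cast at h2 ⊢
  linear_combination (-(c : ℂ)) * h2

lemma rho_mul_eq_line (a v : ℝ) :
    ρ * ((a : ℂ) + (v : ℂ) * Complex.I) =
      ((-(2 * (√2 / 2) * v) : ℝ) : ℂ) + ρ * ((a + v : ℝ) : ℂ) := by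
  rw [line_eq_rho_mul]
  have h := half_sqrt_two_sq
  congr 3
  · linear_combination (2 * v) * h
  · congr 1; linear_combination (-2 * v) * h

/-- Cauchy's theorem for two parallel lines of direction `ρ`. -/
lemma integral_line_eq {φ : ℂ → ℂ} {c₁ c₂ : ℝ} (h12 : c₁ ≤ c₂) (h : GaussDecay φ c₁ c₂)
    (hd : ∀ c ∈ Set.Icc c₁ c₂, ∀ u : ℝ, DifferentiableAt ℂ φ (c + ρ * u)) :
    ∫ u : ℝ, φ (c₁ + ρ * u) = ∫ u : ℝ, φ (c₂ + ρ * u) := by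
  have hr := half_sqrt_two_pos
  have hrr := half_sqrt_two_sq
  have key : ∀ c ∈ Set.Icc c₁ c₂, Integrable (fun a : ℝ =>
      φ (ρ * ((a : ℂ) + ((-(√2 / 2 * c) : ℝ) : ℂ) * Complex.I))) ∧
      ∫ a : ℝ, φ (ρ * ((a : ℂ) + ((-(√2 / 2 * c) : ℝ) : ℂ) * Complex.I)) =
        ∫ u : ℝ, φ (c + ρ * u) := by
    intro c hc
    have e : (fun u : ℝ => φ (c + ρ * u)) = fun u : ℝ => (fun a : ℝ =>
        φ (ρ * ((a : ℂ) + ((-(√2 / 2 * c) : ℝ) : ℂ) * Complex.I))) (u + √2 / 2 * c) := by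
      funext u; simp only [line_eq_rho_mul]
    constructor
    · have := h.integrable hc (hd c hc)
      rw [e] at this
      have := this.comp_sub_right (√2 / 2 * c)
      simpa using this
    · rw [e, integral_add_right_eq_self (fun a : ℝ =>
        φ (ρ * ((a : ℂ) + ((-(√2 / 2 * c) : ℝ) : ℂ) * Complex.I)))]
  obtain ⟨i1, e1⟩ := key c₁ ⟨le_rfl, h12⟩
  obtain ⟨i2, e2⟩ := key c₂ ⟨h12, le_rfl⟩
  rw [← e1, ← e2]
  set r := √2 / 2 with hrdef
  have inv : ∀ v ∈ Set.Icc (-(r * c₂)) (-(r * c₁)), -(2 * r * v) ∈ Set.Icc c₁ c₂ := by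
    intro v hv
    have a1 : r * (r * c₁) = c₁ / 2 := by linear_combination c₁ * hrr
    have a2 : r * (r * c₂) = c₂ / 2 := by linear_combination c₂ * hrr
    have b1 := mul_le_mul_of_nonneg_left hv.1 hr.le
    have b2 := mul_le_mul_of_nonneg_left hv.2 hr.le
    constructor <;> linarith
  have hvert : ∀ σ : ℝ, |σ| = 1 → Tendsto (fun n : ℕ => Complex.I •
      ∫ v : ℝ in (-(r * c₂))..(-(r * c₁)), φ (ρ * (((σ * n : ℝ) : ℂ) + (v : ℂ) * Complex.I)))
      atTop (𝓝 0) := by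
    intro σ hσ
    obtain ⟨C, ε, hε, hb⟩ := h
    set K := |r * c₁| + |r * c₂| with hK
    have hlim : Tendsto (fun n : ℕ => |C| * Real.exp (-ε * ((n : ℝ) - K) ^ 2)
        * |(-(r * c₁)) - (-(r * c₂))|) atTop (𝓝 0) := by
      have : Tendsto (fun n : ℕ => -ε * ((n : ℝ) - K) ^ 2) atTop atBot := by
        have t1 : Tendsto (fun n : ℕ => (n : ℝ) - K) atTop atTop :=
          tendsto_atTop_add_const_right _ _ tendsto_natCast_atTop_atTop
        have t2 := (tendsto_pow_atTop (two_ne_zero)).comp t1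
        exact t2.const_mul_atTop_of_neg (by linarith : -ε < 0)
      have := (Real.tendsto_exp_atBot.comp this).const_mul |C|
      simpa using this.mul_const (|(-(r * c₁)) - (-(r * c₂))|)
    refine squeeze_zero_norm' ?_ hlim
    filter_upwards [eventually_ge_atTop (⌈K + 1⌉₊)] with n hn
    have hn' : K + 1 ≤ n := (Nat.le_ceil _).trans (by exact_mod_cast hn)
    rw [norm_smul, Complex.norm_I, one_mul]
    refine intervalIntegral.norm_integral_le_of_norm_le_const fun v hv => ?_
    have hle : -(r * c₂) ≤ -(r * c₁) := by nlinarith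
    rw [Set.uIoc_of_le hle] at hv
    have hv' : v ∈ Set.Icc (-(r * c₂)) (-(r * c₁)) := ⟨hv.1.le, hv.2⟩
    have habs : |v| ≤ K := by
      rw [hK, abs_le]
      constructor <;> linarith [hv'.1, hv'.2, neg_abs_le (r * c₁), le_abs_self (r * c₂),
        abs_nonneg (r * c₁), abs_nonneg (r * c₂)]
    have hu : (n : ℝ) - K ≤ |σ * n + v| := by
      have h1 : |σ * n| = n := by rw [abs_mul, hσ, one_mul, abs_of_nonneg (Nat.cast_nonneg n)]
      have h2 := abs_sub_abs_le_abs_sub (σ * n) (-v)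
      rw [sub_neg_eq_add, abs_neg, h1] at h2
      linarith
    rw [rho_mul_eq_line]
    refine (hb _ (inv v hv') _ (by linarith)).trans ?_
    have h3 : ((n : ℝ) - K) ^ 2 ≤ (σ * n + v) ^ 2 := by
      rw [← sq_abs (σ * n + v)]
      exact pow_le_pow_left₀ (by linarith) hu 2
    exact mul_le_mul (le_abs_self C) (Real.exp_le_exp.2 (by nlinarith)) (Real.exp_nonneg _)
      (abs_nonneg C)
  have hcauchy : ∀ n : ℕ,
      (∫ a : ℝ in (-(n : ℝ))..n, φ (ρ * ((a : ℂ) + ((-(r * c₂) : ℝ) : ℂ) * Complex.I))) -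
      (∫ a : ℝ in (-(n : ℝ))..n, φ (ρ * ((a : ℂ) + ((-(r * c₁) : ℝ) : ℂ) * Complex.I))) +
      Complex.I • (∫ v : ℝ in (-(r * c₂))..(-(r * c₁)),
        φ (ρ * (((1 * n : ℝ) : ℂ) + (v : ℂ) * Complex.I))) -
      Complex.I • (∫ v : ℝ in (-(r * c₂))..(-(r * c₁)),
        φ (ρ * (((-1 * n : ℝ) : ℂ) + (v : ℂ) * Complex.I))) = 0 := by
    intro n
    have hR := Complex.integral_boundary_rect_eq_zero_of_differentiableOn
      (fun w => φ (ρ * w)) (⟨-(n : ℝ), -(r * c₂)⟩ : ℂ) (⟨(n : ℝ), -(r * c₁)⟩ : ℂ) ?_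
    · simpa using hR
    · intro w hw
      have hle : -(r * c₂) ≤ -(r * c₁) := by nlinarith
      have hw2 : w.im ∈ Set.Icc (-(r * c₂)) (-(r * c₁)) := by
        have := hw.2
        simpa [Set.uIcc_of_le hle] using this
      have e : ρ * w = ((-(2 * r * w.im) : ℝ) : ℂ) + ρ * ((w.re + w.im : ℝ) : ℂ) := by
        rw [← rho_mul_eq_line, Complex.re_add_im]
      have := hd _ (inv _ hw2) (w.re + w.im)
      rw [← e] at this
      exact (DifferentiableAt.comp w this (by fun_prop)).differentiableWithinAt
  have tn : Tendsto (fun n : ℕ => (n : ℝ)) atTop atTop := tendsto_natCast_atTop_atTop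
  have tnn : Tendsto (fun n : ℕ => -(n : ℝ)) atTop atBot := tendsto_neg_atTop_atBot.comp tn
  have L := (((intervalIntegral_tendsto_integral i2 tnn tn).sub
    (intervalIntegral_tendsto_integral i1 tnn tn)).add (hvert 1 (by simp))).sub
      (hvert (-1) (by simp))
  simp only [hcauchy] at L
  have := tendsto_nhds_unique L tendsto_const_nhds
  linear_combination -this

/-! ### The Gaussian factor and the denominator `1 - e^{2πiz}` -/

/-- The Gaussian `e^{iπ(αz² + βz)}`. -/
def quadExp (α β : ℝ) (z : ℂ) : ℂ := Complex.exp (Real.pi * Complex.I * (α * z ^ 2 + β * z))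

/-- The function `1 - e^{2πiz}`, with simple zeros at the integers. -/
def oneSubExp (z : ℂ) : ℂ := 1 - Complex.exp (2 * Real.pi * Complex.I * z)

lemma differentiable_quadExp (α β : ℝ) : Differentiable ℂ (quadExp α β) := by
  unfold quadExp; fun_prop

lemma differentiable_oneSubExp : Differentiable ℂ oneSubExp := by
  unfold oneSubExp; fun_prop

lemma norm_quadExp_line (α β c u : ℝ) :
    ‖quadExp α β (c + ρ * u)‖ =
      Real.exp (-(Real.pi * α * u ^ 2) - Real.pi * (√2 / 2) * u * (2 * α * c + β)) := by
  rw [quadExp, Complex.norm_exp]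
  congr 1
  have h := half_sqrt_two_sq
  have e : (Real.pi * Complex.I * (α * ((c : ℂ) + ρ * u) ^ 2 + β * ((c : ℂ) + ρ * u))).re =
      -(Real.pi * (α * (2 * ((c : ℂ) + ρ * u).re * ((c : ℂ) + ρ * u).im)
        + β * ((c : ℂ) + ρ * u).im)) := by
    generalize (c : ℂ) + ρ * u = z
    simp [pow_two]
    left; ring
  rw [e, line_re, line_im]
  linear_combination (-2 * Real.pi * α * u ^ 2) * h

lemma exists_norm_quadExp_le {α : ℝ} (hα : 0 < α) (β c₁ c₂ : ℝ) :
    ∃ C : ℝ, 0 ≤ C ∧ ∀ c ∈ Set.Icc c₁ c₂, ∀ u : ℝ,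
      ‖quadExp α β (c + ρ * u)‖ ≤ C * Real.exp (-α * u ^ 2) := by
  obtain ⟨B, hB⟩ := (isCompact_Icc (a := c₁) (b := c₂)).exists_bound_of_continuousOn
    (f := fun c => Real.pi * (√2 / 2) * (2 * α * c + β)) (by fun_prop)
  refine ⟨Real.exp (B ^ 2 / (4 * α)), Real.exp_nonneg _, fun c hc u => ?_⟩
  rw [norm_quadExp_line, ← Real.exp_add]
  refine Real.exp_le_exp.2 ?_
  have hb := hB c hc
  rw [Real.norm_eq_abs] at hb
  have e : Real.pi * (√2 / 2) * u * (2 * α * c + β) =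
    u * (Real.pi * (√2 / 2) * (2 * α * c + β)) := by ring
  rw [e]
  generalize Real.pi * (√2 / 2) * (2 * α * c + β) = b at *
  have h1 : b ^ 2 / (4 * α) ≤ B ^ 2 / (4 * α) := by
    gcongr 1
    rw [← sq_abs b]
    exact pow_le_pow_left₀ (abs_nonneg b) hb 2
  have h2 : -(u * b) ≤ α * u ^ 2 + b ^ 2 / (4 * α) := by
    have : α * u ^ 2 + b ^ 2 / (4 * α) + u * b = (2 * α * u + b) ^ 2 / (4 * α) := by
      field_simp; ring
    have : 0 ≤ (2 * α * u + b) ^ 2 / (4 * α) := by positivity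
    linarith
  have h3 : 3 * (α * u ^ 2) ≤ Real.pi * (α * u ^ 2) :=
    mul_le_mul_of_nonneg_right Real.pi_gt_three.le (by positivity)
  nlinarith

lemma norm_exp_line (c u : ℝ) :
    ‖Complex.exp (2 * Real.pi * Complex.I * (c + ρ * u))‖ =
      Real.exp (-(2 * Real.pi * (√2 / 2) * u)) := by
  have h := norm_quadExp_line 0 2 c u
  rw [quadExp] at h
  have e : 2 * Real.pi * Complex.I * ((c : ℂ) + ρ * u) =
      Real.pi * Complex.I * ((0 : ℝ) * ((c : ℂ) + ρ * u) ^ 2 + (2 : ℝ) * (c + ρ * u)) := by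
    push_cast; ring
  rw [e, h]
  congr 1
  ring

lemma half_le_exp_aux {v : ℝ} (hv : 1 ≤ v) : Real.exp (-v) ≤ 1 / 2 := by
  rw [Real.exp_neg, one_div]
  refine inv_anti₀ (by norm_num) ?_
  have := Real.add_one_le_exp v
  linarith

lemma half_le_norm_oneSubExp (c : ℝ) {u : ℝ} (hu : 1 ≤ |u|) :
    1 / 2 ≤ ‖oneSubExp (c + ρ * u)‖ := by
  have hE := norm_exp_line c u
  have hp : 1 ≤ 2 * Real.pi * (√2 / 2) := by
    nlinarith [Real.pi_gt_three, half_sqrt_two_gt]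
  rw [oneSubExp]
  rcases le_abs.1 hu with h | h
  · have h1 : ‖Complex.exp (2 * Real.pi * Complex.I * (c + ρ * u))‖ ≤ 1 / 2 := by
      rw [hE]; exact half_le_exp_aux (by nlinarith)
    have := norm_sub_norm_le (1 : ℂ) (Complex.exp (2 * Real.pi * Complex.I * (c + ρ * u)))
    rw [norm_one] at this
    linarith
  · have h1 : 2 ≤ ‖Complex.exp (2 * Real.pi * Complex.I * (c + ρ * u))‖ := by
      rw [hE]
      have := Real.add_one_le_exp (-(2 * Real.pi * (√2 / 2) * u))
      nlinarith
    have := norm_sub_norm_le (Complex.exp (2 * Real.pi * Complex.I * (c + ρ * u))) (1 : ℂ)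
    rw [norm_one, norm_sub_rev] at this
    linarith

lemma half_le_norm_one_add_exp {v : ℝ} (hv : 0 ≤ v) (σ : ℝ) (hσ : |σ| = 1) :
    1 / 2 ≤ ‖1 + Complex.exp ((-v : ℝ) + (σ * v : ℝ) * Complex.I)‖ := by
  rcases le_total v 1 with h | h
  · refine le_trans ?_ (Complex.re_le_norm _)
    rw [Complex.add_re, Complex.exp_re]
    simp only [Complex.one_re, Complex.add_re, Complex.ofReal_re, Complex.mul_re, Complex.I_re,
      mul_zero, Complex.ofReal_im, Complex.I_im, mul_one, sub_self, add_zero, Complex.add_im,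
      Complex.mul_im, zero_add]
    have : 0 ≤ Real.cos (σ * v) := by
      have h2 : |σ * v| ≤ 1 := by rw [abs_mul, hσ, one_mul, abs_of_nonneg hv]; exact h
      have h3 := abs_le.1 h2
      exact Real.cos_nonneg_of_mem_Icc ⟨by linarith [Real.pi_gt_three],
        by linarith [Real.pi_gt_three]⟩
    have := mul_nonneg (Real.exp_nonneg (-v)) this
    linarith
  · have h1 : ‖Complex.exp ((-v : ℝ) + (σ * v : ℝ) * Complex.I)‖ ≤ 1 / 2 := by
      rw [Complex.norm_exp]
      simpa using half_le_exp_aux h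
    have := norm_sub_norm_le (1 : ℂ) (-Complex.exp ((-v : ℝ) + (σ * v : ℝ) * Complex.I))
    rw [norm_one, norm_neg, sub_neg_eq_add] at this
    linarith

lemma oneSubExp_half_line (n : ℕ) (u : ℝ) :
    oneSubExp ((n + 1 / 2 : ℝ) + ρ * u) =
      1 + Complex.exp ((-(2 * Real.pi * (√2 / 2) * u) : ℝ) +
        ((2 * Real.pi * (√2 / 2) * u : ℝ) : ℂ) * Complex.I) := by
  have e : 2 * Real.pi * Complex.I * (((n + 1 / 2 : ℝ) : ℂ) + ρ * u) =
      ((n : ℂ) * (2 * Real.pi * Complex.I) + Real.pi * Complex.I) +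
      ((-(2 * Real.pi * (√2 / 2) * u) : ℝ) +
        ((2 * Real.pi * (√2 / 2) * u : ℝ) : ℂ) * Complex.I) := by
    rw [rho_eq]; push_cast
    linear_combination (Real.pi * √2 * u) * Complex.I_sq
  rw [oneSubExp, e, Complex.exp_add, Complex.exp_add, Complex.exp_nat_mul_two_pi_mul_I,
    Complex.exp_pi_mul_I]
  ring

lemma exp_le_norm_oneSubExp (n : ℕ) (u : ℝ) {θ : ℝ} (h0 : 0 ≤ θ) (h1 : θ ≤ 1) :
    1 / 2 * Real.exp (-(2 * Real.pi * (√2 / 2) * u) * θ) ≤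
      ‖oneSubExp ((n + 1 / 2 : ℝ) + ρ * u)‖ := by
  rw [oneSubExp_half_line]
  generalize 2 * Real.pi * (√2 / 2) * u = v
  rcases le_total 0 v with hv | hv
  · have := half_le_norm_one_add_exp hv 1 (by simp)
    rw [one_mul] at this
    refine le_trans ?_ this
    have : Real.exp (-v * θ) ≤ 1 := Real.exp_le_one_iff.2 (by nlinarith)
    linarith
  · have h2 := half_le_norm_one_add_exp (neg_nonneg.2 hv) 1 (by simp)
    have e : 1 + Complex.exp ((-v : ℝ) + (v : ℂ) * Complex.I) =
        Complex.exp ((-v : ℝ) + (v : ℂ) * Complex.I) *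
          (1 + Complex.exp ((-(-v) : ℝ) + (1 * (-v) : ℝ) * Complex.I)) := by
      rw [mul_add, ← Complex.exp_add, mul_one, add_comm]
      congr 1
      rw [← Complex.exp_zero]
      congr 1
      push_cast; ring
    rw [e, norm_mul, Complex.norm_exp]
    have h3 : Real.exp (-v * θ) ≤ Real.exp (-v) := Real.exp_le_exp.2 (by nlinarith)
    have h4 : (((-v : ℝ) : ℂ) + (v : ℂ) * Complex.I).re = -v := by simp
    rw [h4]
    nlinarith [Real.exp_pos (-v)]

lemma oneSubExp_half_line_ne_zero (n : ℕ) (u : ℝ) :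
    oneSubExp ((n + 1 / 2 : ℝ) + ρ * u) ≠ 0 := by
  have := exp_le_norm_oneSubExp n u le_rfl zero_le_one
  rw [mul_zero, Real.exp_zero] at this
  rw [← norm_pos_iff]; linarith

lemma oneSubExp_eq_zero_iff_of_mem {k : ℕ} {c u : ℝ}
    (hc : c ∈ Set.Icc ((k : ℝ) - 1 / 2) (k + 1 / 2)) (h : oneSubExp (c + ρ * u) = 0) :
    (c : ℂ) + ρ * u = k := by
  rw [oneSubExp, sub_eq_zero, eq_comm, Complex.exp_eq_one_iff] at h
  obtain ⟨m, hm⟩ := h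
  have e : (c : ℂ) + ρ * u = m := by
    have h2 : (2 * Real.pi * Complex.I : ℂ) ≠ 0 := Complex.two_pi_I_ne_zero
    apply mul_left_cancel₀ h2
    rw [hm]; ring
  have him := congrArg Complex.im e
  rw [line_im, Complex.intCast_im] at him
  have hu : u = 0 := by
    rcases mul_eq_zero.1 him with h | h
    · exact absurd h half_sqrt_two_pos.ne'
    · exact h
  have hre := congrArg Complex.re e
  rw [line_re, hu, Complex.intCast_re, mul_zero, add_zero] at hre
  rw [e]
  have h3 : ((m : ℝ)) - k ≤ 1 / 2 := by linarith [hc.2]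
  have h4 : -(1 / 2) ≤ ((m : ℝ)) - k := by linarith [hc.1]
  have h5 : m - k < 1 := by
    have : ((m - k : ℤ) : ℝ) < 1 := by push_cast; linarith
    exact_mod_cast this
  have h6 : -1 < m - k := by
    have : (-1 : ℝ) < ((m - k : ℤ) : ℝ) := by push_cast; linarith
    exact_mod_cast this
  have : m = k := by omega
  rw [this]; simp

/-! ### The contour integral representation of partial sums -/

/-- The integrand `e^{iπ(yz² - 2mz)} / z^s`. -/
def powKernel (s y : ℝ) (m : ℕ) (z : ℂ) : ℂ := quadExp y (-2 * m) z / z ^ (s : ℂ)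

/-- The integrand `e^{iπ(yz² - 2mz)} / (z^s (1 - e^{2πiz}))`. -/
def poleKernel (s y : ℝ) (m : ℕ) (z : ℂ) : ℂ :=
  quadExp y (-2 * m) z / (z ^ (s : ℂ) * oneSubExp z)

/-- The integral of `poleKernel` over the line `n + 1/2 + ρ u`, without the factor `ρ`. -/
def lineRem (s y : ℝ) (m n : ℕ) : ℂ := ∫ u : ℝ, poleKernel s y m ((n + 1 / 2 : ℝ) + ρ * u)

lemma cpow_line_ne_zero (s : ℝ) {c : ℝ} (hc : 0 < c) (u : ℝ) :
    ((c : ℂ) + ρ * u) ^ (s : ℂ) ≠ 0 := by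
  rw [Complex.cpow_def_of_ne_zero (Complex.slitPlane_ne_zero (line_mem_slitPlane hc u))]
  exact Complex.exp_ne_zero _

lemma differentiableAt_cpow {z : ℂ} (s : ℝ) (hz : z ∈ Complex.slitPlane) :
    DifferentiableAt ℂ (fun z : ℂ => z ^ (s : ℂ)) z :=
  differentiableAt_id.cpow_const hz

lemma differentiableAt_powKernel (s y : ℝ) (m : ℕ) {c : ℝ} (hc : 0 < c) (u : ℝ) :
    DifferentiableAt ℂ (powKernel s y m) (c + ρ * u) :=
  (differentiable_quadExp _ _ _).div (differentiableAt_cpow s (line_mem_slitPlane hc u))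
    (cpow_line_ne_zero s hc u)

lemma differentiableAt_poleKernel (s y : ℝ) (m n : ℕ) (u : ℝ) :
    DifferentiableAt ℂ (poleKernel s y m) ((n + 1 / 2 : ℝ) + ρ * u) := by
  have hc : (0 : ℝ) < n + 1 / 2 := by positivity
  exact (differentiable_quadExp _ _ _).div
    ((differentiableAt_cpow s (line_mem_slitPlane hc u)).mul (differentiable_oneSubExp _))
    (mul_ne_zero (cpow_line_ne_zero s hc u) (oneSubExp_half_line_ne_zero n u))

lemma rpow_le_norm_cpow_line {s : ℝ} (hs : 0 < s) {c : ℝ} (hc : 0 < c) (u : ℝ) :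
    (c / 2) ^ s ≤ ‖((c : ℂ) + ρ * u) ^ (s : ℂ)‖ := by
  rw [Complex.norm_cpow_real]
  exact Real.rpow_le_rpow (by positivity) (half_le_norm_line u) hs.le

lemma gaussDecay_powKernel {s y : ℝ} (hs : 0 < s) (hy : 0 < y) (m : ℕ) {c₁ c₂ : ℝ} (hc : 0 < c₁) :
    GaussDecay (powKernel s y m) c₁ c₂ := by
  obtain ⟨C, hC, hb⟩ := exists_norm_quadExp_le hy (-2 * m) c₁ c₂
  refine ⟨C / (c₁ / 2) ^ s, y, hy, fun c hcc u _ => ?_⟩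
  rw [powKernel, norm_div]
  calc _ ≤ C * Real.exp (-y * u ^ 2) / (c₁ / 2) ^ s := by
        gcongr
        · exact hb c hcc u
        · refine le_trans ?_ (rpow_le_norm_cpow_line hs (hc.trans_le hcc.1) u)
          have := hcc.1
          gcongr
    _ = _ := by ring

lemma gaussDecay_div_oneSubExp {φ : ℂ → ℂ} {c₁ c₂ : ℝ} (h : GaussDecay φ c₁ c₂) :
    GaussDecay (fun z => φ z / oneSubExp z) c₁ c₂ := by
  obtain ⟨C, ε, hε, hb⟩ := h
  refine ⟨2 * C, ε, hε, fun c hc u hu => ?_⟩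
  have h1 := half_le_norm_oneSubExp c hu
  rw [norm_div, div_le_iff₀ (by linarith)]
  have h2 := hb c hc u hu
  have h3 : 0 ≤ C * Real.exp (-ε * u ^ 2) := (norm_nonneg _).trans h2
  nlinarith

lemma GaussDecay.sub_const_mul {φ χ : ℂ → ℂ} {c₁ c₂ : ℝ} (h : GaussDecay φ c₁ c₂)
    (h' : GaussDecay χ c₁ c₂) (a : ℂ) : GaussDecay (fun z => φ z - a * χ z) c₁ c₂ := by
  obtain ⟨C, ε, hε, hb⟩ := h
  obtain ⟨C', ε', hε', hb'⟩ := h'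
  refine ⟨|C| + ‖a‖ * |C'|, min ε ε', lt_min hε hε', fun c hc u hu => ?_⟩
  have e1 : Real.exp (-ε * u ^ 2) ≤ Real.exp (-(min ε ε') * u ^ 2) :=
    Real.exp_le_exp.2 (by nlinarith [min_le_left ε ε', sq_nonneg u])
  have e2 : Real.exp (-ε' * u ^ 2) ≤ Real.exp (-(min ε ε') * u ^ 2) :=
    Real.exp_le_exp.2 (by nlinarith [min_le_right ε ε', sq_nonneg u])
  calc _ ≤ ‖φ (c + ρ * u)‖ + ‖a‖ * ‖χ (c + ρ * u)‖ := by
        rw [← norm_mul]; exact norm_sub_le _ _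
    _ ≤ C * Real.exp (-ε * u ^ 2) + ‖a‖ * (C' * Real.exp (-ε' * u ^ 2)) := by
        gcongr
        · exact hb c hc u hu
        · exact hb' c hc u hu
    _ ≤ |C| * Real.exp (-(min ε ε') * u ^ 2) +
          ‖a‖ * (|C'| * Real.exp (-(min ε ε') * u ^ 2)) := by
        gcongr
        · exact le_abs_self C
        · exact le_abs_self C'
    _ = _ := by ring

lemma gaussDecay_quadExp {α : ℝ} (hα : 0 < α) (β c₁ c₂ : ℝ) :
    GaussDecay (quadExp α β) c₁ c₂ := by
  obtain ⟨C, hC, hb⟩ := exists_norm_quadExp_le hα β c₁ c₂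
  exact ⟨C, α, hα, fun c hc u _ => hb c hc u⟩

lemma poleKernel_eq (s y : ℝ) (m : ℕ) :
    poleKernel s y m = fun z => powKernel s y m z / oneSubExp z := by
  funext z; rw [poleKernel, powKernel, div_div]

lemma integrable_poleKernel {s y : ℝ} (hs : 0 < s) (hy : 0 < y) (m n : ℕ) :
    Integrable (fun u : ℝ => poleKernel s y m ((n + 1 / 2 : ℝ) + ρ * u)) := by
  have hc : (0 : ℝ) < n + 1 / 2 := by positivity
  have h := gaussDecay_div_oneSubExp (gaussDecay_powKernel (c₂ := n + 1 / 2) hs hy m hc)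
  rw [← poleKernel_eq] at h
  exact h.integrable ⟨le_rfl, le_rfl⟩ (differentiableAt_poleKernel s y m n)

lemma quadExp_succ (y : ℝ) (m : ℕ) (z : ℂ) :
    quadExp y (-2 * m) z - quadExp y (-2 * (m + 1 : ℕ)) z =
      -(quadExp y (-2 * (m + 1 : ℕ)) z * oneSubExp z) := by
  have : quadExp y (-2 * m) z =
      quadExp y (-2 * (m + 1 : ℕ)) z * Complex.exp (2 * Real.pi * Complex.I * z) := by
    rw [quadExp, quadExp, ← Complex.exp_add]
    congr 1
    push_cast; ring
  rw [this, oneSubExp]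
  ring

lemma integral_powKernel_eq {s y : ℝ} (hs : 0 < s) (hy : 0 < y) (m : ℕ) {c₁ c₂ : ℝ}
    (h₁ : 0 < c₁) (h₂ : 0 < c₂) :
    ∫ u : ℝ, powKernel s y m (c₁ + ρ * u) = ∫ u : ℝ, powKernel s y m (c₂ + ρ * u) := by
  rcases le_total c₁ c₂ with h | h
  · exact integral_line_eq h (gaussDecay_powKernel hs hy m h₁)
      fun c hc u => differentiableAt_powKernel s y m (h₁.trans_le hc.1) u
  · exact (integral_line_eq h (gaussDecay_powKernel hs hy m h₂)
      fun c hc u => differentiableAt_powKernel s y m (h₂.trans_le hc.1) u).symm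

lemma real_mul_cpow {a : ℝ} (ha : 0 < a) {w : ℂ} (hw : w ≠ 0) (s : ℝ) :
    ((a : ℂ) * w) ^ (s : ℂ) = (a : ℂ) ^ (s : ℂ) * w ^ (s : ℂ) := by
  have ha' : (a : ℂ) ≠ 0 := by exact_mod_cast ha.ne'
  rw [Complex.cpow_def_of_ne_zero (mul_ne_zero ha' hw), Complex.cpow_def_of_ne_zero ha',
    Complex.cpow_def_of_ne_zero hw, Complex.log_ofReal_mul ha hw, ← Complex.exp_add,
    Complex.ofReal_log ha.le]
  congr 1; ring

lemma powKernel_saddle {s y : ℝ} (hy : 0 < y) {k : ℕ} (hk : 0 < k) (u : ℝ) :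
    powKernel s y k ((k / y : ℝ) + ρ * u) =
      Complex.exp (-(Real.pi * Complex.I * (k : ℂ) ^ 2 / (y : ℂ))) * (y : ℂ) ^ (s : ℂ) *
        ((Real.exp (-(Real.pi * y * u ^ 2)) : ℝ) * ((ρ * (y : ℂ) * (u : ℂ) + k) ^ (s : ℂ))⁻¹) := by
  have hy' : (y : ℂ) ≠ 0 := by exact_mod_cast hy.ne'
  have hk' : (0 : ℝ) < k / y := by positivity
  have e1 : ρ * (y : ℂ) * (u : ℂ) + k = y * ((k / y : ℝ) + ρ * u) := by
    push_cast; field_simp; ring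
  have hne := Complex.slitPlane_ne_zero (line_mem_slitPlane hk' u)
  have e2 : quadExp y (-2 * k) ((k / y : ℝ) + ρ * u) =
      Complex.exp (-(Real.pi * Complex.I * (k : ℂ) ^ 2 / (y : ℂ))) *
        (Real.exp (-(Real.pi * y * u ^ 2)) : ℝ) := by
    rw [quadExp, Complex.ofReal_exp, ← Complex.exp_add]
    congr 1
    push_cast
    field_simp
    linear_combination (y ^ 2 * u ^ 2 * Complex.I) * rho_sq + (y ^ 2 * u ^ 2) * Complex.I_sq
  have h3 : (y : ℂ) ^ (s : ℂ) ≠ 0 := by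
    rw [Complex.cpow_def_of_ne_zero hy']; exact Complex.exp_ne_zero _
  rw [powKernel, e2, e1, real_mul_cpow hy hne, mul_inv]
  field_simp

lemma lineRem_succ {s y : ℝ} (hs : 0 < s) (hy : 0 < y) (m n : ℕ) :
    lineRem s y m n - lineRem s y (m + 1) n =
      -(Complex.exp (-(Real.pi * Complex.I * ((m + 1 : ℕ) : ℂ) ^ 2 / (y : ℂ))) *
        (y : ℂ) ^ (s : ℂ) * ∫ u : ℝ, ((Real.exp (-(Real.pi * y * u ^ 2)) : ℝ) : ℂ) *
          ((ρ * (y : ℂ) * (u : ℂ) + (m + 1 : ℕ)) ^ (s : ℂ))⁻¹) := by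
  have hn : (0 : ℝ) < n + 1 / 2 := by positivity
  rw [lineRem, lineRem, ← integral_sub (integrable_poleKernel hs hy m n)
    (integrable_poleKernel hs hy (m + 1) n)]
  have e : ∀ u : ℝ, poleKernel s y m ((n + 1 / 2 : ℝ) + ρ * u) -
      poleKernel s y (m + 1) ((n + 1 / 2 : ℝ) + ρ * u) =
      -powKernel s y (m + 1) ((n + 1 / 2 : ℝ) + ρ * u) := by
    intro u
    have h1 := oneSubExp_half_line_ne_zero n u
    have h2 := cpow_line_ne_zero s hn u
    generalize (((n : ℝ) + 1 / 2 : ℝ) : ℂ) + ρ * u = z at h1 h2 ⊢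
    rw [poleKernel, poleKernel, powKernel, ← sub_div, quadExp_succ]
    field_simp
  simp_rw [e]
  rw [integral_neg, integral_powKernel_eq hs hy (m + 1) hn
    (show (0 : ℝ) < (m + 1 : ℕ) / y by positivity)]
  simp_rw [powKernel_saddle hy (Nat.succ_pos m)]
  rw [integral_const_mul]

/-- The entire function `e^{iπ((z-k)² + (z-k))}`, which has a known integral against
`1 / (1 - e^{2πiz})`. -/
def refKernel (k : ℕ) (z : ℂ) : ℂ := quadExp 1 1 (z - k)

lemma differentiable_refKernel (k : ℕ) : Differentiable ℂ (refKernel k) := by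
  unfold refKernel
  exact (differentiable_quadExp 1 1).comp (by fun_prop)

lemma gaussDecay_refKernel (k : ℕ) (c₁ c₂ : ℝ) : GaussDecay (refKernel k) c₁ c₂ := by
  obtain ⟨C, ε, hε, hb⟩ := gaussDecay_quadExp one_pos 1 (c₁ - k) (c₂ - k)
  refine ⟨C, ε, hε, fun c hc u hu => ?_⟩
  have := hb (c - k) ⟨by linarith [hc.1], by linarith [hc.2]⟩ u hu
  rw [refKernel]
  convert this using 3
  push_cast; ring

lemma refKernel_self (k : ℕ) : refKernel k k = 1 := by simp [refKernel, quadExp]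

lemma integrable_refKernel_div (k n : ℕ) :
    Integrable (fun u : ℝ => refKernel k ((n + 1 / 2 : ℝ) + ρ * u) /
      oneSubExp ((n + 1 / 2 : ℝ) + ρ * u)) := by
  refine (gaussDecay_div_oneSubExp (gaussDecay_refKernel k (n + 1 / 2) (n + 1 / 2))).integrable
    ⟨le_rfl, le_rfl⟩ fun u => ?_
  exact (differentiable_refKernel k _).div (differentiable_oneSubExp _)
    (oneSubExp_half_line_ne_zero n u)

lemma integral_refKernel (n : ℕ) :
    ρ * (∫ u : ℝ, refKernel (n + 1) ((n + 1 / 2 : ℝ) + ρ * u) /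
      oneSubExp ((n + 1 / 2 : ℝ) + ρ * u)) -
    ρ * (∫ u : ℝ, refKernel (n + 1) (((n + 1 : ℕ) + 1 / 2 : ℝ) + ρ * u) /
      oneSubExp (((n + 1 : ℕ) + 1 / 2 : ℝ) + ρ * u)) = 1 := by
  rw [← mul_sub, ← integral_sub (integrable_refKernel_div (n + 1) n)
    (integrable_refKernel_div (n + 1) (n + 1))]
  have e : ∀ u : ℝ, refKernel (n + 1) ((n + 1 / 2 : ℝ) + ρ * u) /
      oneSubExp ((n + 1 / 2 : ℝ) + ρ * u) -
      refKernel (n + 1) (((n + 1 : ℕ) + 1 / 2 : ℝ) + ρ * u) /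
      oneSubExp (((n + 1 : ℕ) + 1 / 2 : ℝ) + ρ * u) =
      ρ⁻¹ * ((Real.exp (-Real.pi * u ^ 2) : ℝ) : ℂ) := by
    intro u
    have hz : (((n + 1 : ℕ) + 1 / 2 : ℝ) : ℂ) + ρ * u = (((n + 1 / 2 : ℝ) : ℂ) + ρ * u) + 1 := by
      push_cast; ring
    rw [hz]
    have hne := oneSubExp_half_line_ne_zero n u
    have h1 : oneSubExp ((((n + 1 / 2 : ℝ) : ℂ) + ρ * u) + 1) =
        oneSubExp (((n + 1 / 2 : ℝ) : ℂ) + ρ * u) := by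
      rw [oneSubExp, oneSubExp, mul_add, mul_one, Complex.exp_add, Complex.exp_two_pi_mul_I,
        mul_one]
    have h2 : refKernel (n + 1) ((((n + 1 / 2 : ℝ) : ℂ) + ρ * u) + 1) =
        refKernel (n + 1) (((n + 1 / 2 : ℝ) : ℂ) + ρ * u) *
          Complex.exp (2 * Real.pi * Complex.I * (((n + 1 / 2 : ℝ) : ℂ) + ρ * u)) := by
      have hper : Complex.exp (2 * Real.pi * Complex.I * (((n + 1 / 2 : ℝ) : ℂ) + ρ * u)) =
          Complex.exp (2 * Real.pi * Complex.I * (((n + 1 / 2 : ℝ) : ℂ) + ρ * u) -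
            n * (2 * Real.pi * Complex.I)) := by
        rw [Complex.exp_sub, Complex.exp_nat_mul_two_pi_mul_I, div_one]
      rw [hper, refKernel, refKernel, quadExp, quadExp, ← Complex.exp_add]
      congr 1
      push_cast; ring
    rw [h1, h2, ← sub_div]
    have h3 : refKernel (n + 1) (((n + 1 / 2 : ℝ) : ℂ) + ρ * u) -
        refKernel (n + 1) (((n + 1 / 2 : ℝ) : ℂ) + ρ * u) *
          Complex.exp (2 * Real.pi * Complex.I * (((n + 1 / 2 : ℝ) : ℂ) + ρ * u)) =
        refKernel (n + 1) (((n + 1 / 2 : ℝ) : ℂ) + ρ * u) *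
          oneSubExp (((n + 1 / 2 : ℝ) : ℂ) + ρ * u) := by
      rw [oneSubExp]; ring
    rw [h3, mul_div_cancel_right₀ _ hne, refKernel, quadExp, ρ, ← Complex.exp_neg,
      Complex.ofReal_exp, ← Complex.exp_add]
    congr 1
    rw [← ρ]
    push_cast
    linear_combination (Real.pi * Complex.I * u ^ 2) * rho_sq + (Real.pi * u ^ 2) * Complex.I_sq
  simp_rw [e]
  rw [integral_const_mul, ← mul_assoc, mul_inv_cancel₀ rho_ne_zero, one_mul, integral_complex_ofReal,
    integral_gaussian, div_self Real.pi_ne_zero, Real.sqrt_one, Complex.ofReal_one]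

lemma deriv_oneSubExp_natCast (k : ℕ) : deriv oneSubExp k ≠ 0 := by
  have h : HasDerivAt oneSubExp (-(Complex.exp (2 * Real.pi * Complex.I * k) *
      (2 * Real.pi * Complex.I * 1))) k :=
    (((hasDerivAt_id (k : ℂ)).const_mul (2 * Real.pi * Complex.I)).cexp).const_sub 1
  rw [h.deriv]
  exact neg_ne_zero.2 (mul_ne_zero (Complex.exp_ne_zero _)
    (by rw [mul_one]; exact Complex.two_pi_I_ne_zero))

lemma oneSubExp_natCast (k : ℕ) : oneSubExp k = 0 := by
  rw [oneSubExp, mul_comm, Complex.exp_nat_mul_two_pi_mul_I, sub_self]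

/-- The residue theorem for the pole at `n + 1`. -/
lemma rho_mul_lineRem_sub {s y : ℝ} (hs : 0 < s) (hy : 0 < y) (n : ℕ) :
    ρ * lineRem s y 0 n - ρ * lineRem s y 0 (n + 1) = powKernel s y 0 ((n + 1 : ℕ) : ℂ) := by
  set k := n + 1 with hk
  set a := powKernel s y 0 (k : ℂ) with ha
  set N : ℂ → ℂ := fun z => powKernel s y 0 z - a * refKernel k z with hN
  have hNk : N k = 0 := by simp only [hN, refKernel_self, mul_one, ha, sub_self]
  set φ : ℂ → ℂ := fun z => dslope N k z / dslope oneSubExp k z with hφ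
  have hφ_eq : ∀ z, z ≠ (k : ℂ) → φ z = N z / oneSubExp z := by
    intro z hz
    have : (z - k : ℂ) ≠ 0 := sub_ne_zero.2 hz
    simp only [hφ, dslope_of_ne _ hz, slope_def_field, hNk, oneSubExp_natCast, sub_zero]
    rw [div_div_div_cancel_right₀ this]
  have hslit : Complex.slitPlane ∈ 𝓝 (k : ℂ) :=
    Complex.isOpen_slitPlane.mem_nhds (by
      rw [Complex.mem_slitPlane_iff]; left; rw [hk]; simp; positivity)
  have hpos : ∀ c ∈ Set.Icc ((n : ℝ) + 1 / 2) ((k : ℝ) + 1 / 2), 0 < c := fun c hc =>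
    lt_of_lt_of_le (by positivity) hc.1
  have hdN : DifferentiableOn ℂ (dslope N k) Complex.slitPlane := by
    rw [Complex.differentiableOn_dslope hslit]
    intro z hz
    refine DifferentiableAt.differentiableWithinAt ?_
    refine DifferentiableAt.sub ?_ ((differentiable_refKernel k z).const_mul a)
    refine (differentiable_quadExp _ _ _).div (differentiableAt_cpow s hz) ?_
    rw [Complex.cpow_def_of_ne_zero (Complex.slitPlane_ne_zero hz)]
    exact Complex.exp_ne_zero _
  have hdD : Differentiable ℂ (dslope oneSubExp k) := by
    rw [← differentiableOn_univ, Complex.differentiableOn_dslope Filter.univ_mem]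
    exact differentiable_oneSubExp.differentiableOn
  have hDne : ∀ c ∈ Set.Icc ((n : ℝ) + 1 / 2) ((k : ℝ) + 1 / 2), ∀ u : ℝ,
      dslope oneSubExp k (c + ρ * u) ≠ 0 := by
    intro c hc u
    by_cases hz : (c : ℂ) + ρ * u = k
    · rw [hz, dslope_same]; exact deriv_oneSubExp_natCast k
    · rw [dslope_of_ne _ hz, slope_def_field, oneSubExp_natCast, sub_zero]
      refine div_ne_zero (fun h0 => hz ?_) (sub_ne_zero.2 hz)
      refine oneSubExp_eq_zero_iff_of_mem ⟨?_, hc.2⟩ h0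
      have := hc.1
      rw [hk]; push_cast; linarith
  have hd : ∀ c ∈ Set.Icc ((n : ℝ) + 1 / 2) ((k : ℝ) + 1 / 2), ∀ u : ℝ,
      DifferentiableAt ℂ φ (c + ρ * u) := by
    intro c hc u
    have hz := line_mem_slitPlane (hpos c hc) u
    exact ((hdN _ hz).differentiableAt (Complex.isOpen_slitPlane.mem_nhds hz)).div (hdD _)
      (hDne c hc u)
  have hnek : ∀ c u : ℝ, u ≠ 0 → (c : ℂ) + ρ * u ≠ k := by
    intro c u hu h
    have := congrArg Complex.im h
    rw [line_im, Complex.natCast_im] at this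
    exact mul_ne_zero half_sqrt_two_pos.ne' hu this
  have hdecN : GaussDecay N (n + 1 / 2) (k + 1 / 2) :=
    (gaussDecay_powKernel hs hy 0 (by positivity)).sub_const_mul (gaussDecay_refKernel k _ _) a
  have hdec : GaussDecay φ (n + 1 / 2) (k + 1 / 2) := by
    obtain ⟨C, ε, hε, hb⟩ := gaussDecay_div_oneSubExp hdecN
    refine ⟨C, ε, hε, fun c hc u hu => ?_⟩
    rw [hφ_eq _ (hnek c u (by rintro rfl; simp at hu; linarith))]
    exact hb c hc u hu
  have hle : (n : ℝ) + 1 / 2 ≤ k + 1 / 2 := by rw [hk]; push_cast; linarith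
  have key := integral_line_eq hle hdec hd
  have hval : ∀ j : ℕ, ∫ u : ℝ, φ ((j + 1 / 2 : ℝ) + ρ * u) = lineRem s y 0 j -
      a * ∫ u : ℝ, refKernel k ((j + 1 / 2 : ℝ) + ρ * u) /
        oneSubExp ((j + 1 / 2 : ℝ) + ρ * u) := by
    intro j
    rw [lineRem, ← integral_const_mul, ← integral_sub (integrable_poleKernel hs hy 0 j)
      ((integrable_refKernel_div k j).const_mul a)]
    congr 1
    funext u
    have hne := oneSubExp_half_line_ne_zero j u
    rw [hφ_eq _ (fun h => hne (by rw [h, oneSubExp_natCast])), hN, poleKernel_eq, sub_div,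
      mul_div_assoc]
  rw [hval n, hval k] at key
  have href := integral_refKernel n
  rw [← hk] at href
  linear_combination ρ * key + a * href

/-! ### Gaussian moments -/

lemma integrable_integral_abs_rpow_mul_exp {q y : ℝ} (hq : -1 < q) (hy : 0 < y) :
    Integrable (fun u : ℝ => |u| ^ q * Real.exp (-(Real.pi * y * u ^ 2))) ∧
    ∫ u : ℝ, |u| ^ q * Real.exp (-(Real.pi * y * u ^ 2)) =
      (Real.pi * y) ^ (-(q + 1) / 2) * Real.Gamma ((q + 1) / 2) := by
  have hb : 0 < Real.pi * y := mul_pos Real.pi_pos hy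
  have h1 := integral_rpow_mul_exp_neg_mul_rpow two_pos hq hb
  have h2 := integral_comp_abs
    (f := fun u : ℝ => u ^ q * Real.exp (-(Real.pi * y) * u ^ (2 : ℝ)))
  rw [h1] at h2
  have e : (fun u : ℝ => |u| ^ q * Real.exp (-(Real.pi * y) * |u| ^ (2 : ℝ))) =
      fun u : ℝ => |u| ^ q * Real.exp (-(Real.pi * y * u ^ 2)) := by
    funext u
    rw [Real.rpow_two, sq_abs, neg_mul]
  rw [e] at h2
  have h3 : ∫ u : ℝ, |u| ^ q * Real.exp (-(Real.pi * y * u ^ 2)) =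
      (Real.pi * y) ^ (-(q + 1) / 2) * Real.Gamma ((q + 1) / 2) := by
    rw [h2]; ring
  refine ⟨Integrable.of_integral_ne_zero ?_, h3⟩
  rw [h3]
  have := Real.Gamma_pos_of_pos (show 0 < (q + 1) / 2 by linarith)
  positivity

lemma integral_exp_neg_pi_mul {y : ℝ} (hy : 0 < y) :
    ∫ u : ℝ, Real.exp (-(Real.pi * y * u ^ 2)) = y ^ (-(1 / 2) : ℝ) := by
  have h := integral_gaussian (Real.pi * y)
  simp_rw [neg_mul] at h
  rw [h, div_mul_cancel_left₀ Real.pi_ne_zero, Real.sqrt_eq_rpow, Real.rpow_neg hy.le,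
    Real.inv_rpow hy.le]

lemma integrable_exp_neg_pi_mul {y : ℝ} (hy : 0 < y) :
    Integrable (fun u : ℝ => Real.exp (-(Real.pi * y * u ^ 2))) := by
  have h := integrable_exp_neg_mul_sq (mul_pos Real.pi_pos hy)
  simpa only [neg_mul] using h

/-! ### The correction series -/

lemma norm_inv_cpow_sub_le {s : ℝ} (hs : 0 < s) {k : ℝ} (hk : 0 < k) (v : ℝ) :
    ‖(((k : ℂ) + ρ * v) ^ (s : ℂ))⁻¹ - ((k : ℂ) ^ (s : ℂ))⁻¹‖ ≤
      s * (k / 2) ^ (-s - 1) * |v| := by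
  have hder : ∀ w ∈ (Set.univ : Set ℝ), HasDerivWithinAt
      (fun w : ℝ => ((k : ℂ) + ρ * w) ^ (-(s : ℂ)))
      (-(s : ℂ) * ((k : ℂ) + ρ * w) ^ (-(s : ℂ) - 1) * ρ) Set.univ w := by
    intro w _
    have h1 : HasDerivAt (fun w : ℝ => (k : ℂ) + ρ * w) ρ w := by
      have := ((hasDerivAt_id w).ofReal_comp.const_mul ρ).const_add (k : ℂ)
      simpa using this
    have h2 : HasDerivAt (fun z : ℂ => z ^ (-(s : ℂ)))
        (-(s : ℂ) * ((k : ℂ) + ρ * w) ^ (-(s : ℂ) - 1)) ((k : ℂ) + ρ * w) := by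
      simpa using (hasDerivAt_id ((k : ℂ) + ρ * w)).cpow_const (c := -(s : ℂ))
        (line_mem_slitPlane hk w)
    exact (HasDerivAt.comp (h := fun w : ℝ => (k : ℂ) + ρ * w) w h2 h1).hasDerivWithinAt
  have hbd : ∀ w ∈ (Set.univ : Set ℝ),
      ‖-(s : ℂ) * ((k : ℂ) + ρ * w) ^ (-(s : ℂ) - 1) * ρ‖ ≤ s * (k / 2) ^ (-s - 1) := by
    intro w _
    have e : (-(s : ℂ) - 1) = ((-s - 1 : ℝ) : ℂ) := by push_cast; ring
    rw [norm_mul, norm_mul, norm_rho, mul_one, norm_neg, Complex.norm_real, Real.norm_eq_abs,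
      abs_of_pos hs, e, Complex.norm_cpow_real]
    gcongr 1
    exact Real.rpow_le_rpow_of_nonpos (by positivity) (half_le_norm_line w) (by linarith)
  have := convex_univ.norm_image_sub_le_of_norm_hasDerivWithin_le hder hbd
    (Set.mem_univ 0) (Set.mem_univ v)
  simpa [Complex.cpow_neg] using this

/-- The `k`-th term of the series in the second integral defining `Ifun s y 0`. -/
def corrTerm (s y u : ℝ) (k : ℕ) : ℂ :=
  Complex.exp (-(Real.pi * Complex.I * ((k : ℂ) + 1) ^ 2 / (y : ℂ))) *
    (((ρ * (y : ℂ) * (u : ℂ) + ((k : ℂ) + 1)) ^ (s : ℂ))⁻¹ - (((k : ℂ) + 1) ^ (s : ℂ))⁻¹)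

/-- The coefficient in the bound `norm_corrTerm_le`. -/
def corrBound (s : ℝ) (k : ℕ) : ℝ := s * (((k : ℝ) + 1) / 2) ^ (-s - 1)

lemma norm_exp_neg_div (y a : ℝ) :
    ‖Complex.exp (-(Real.pi * Complex.I * (a : ℂ) ^ 2 / (y : ℂ)))‖ = 1 := by
  have : (-(Real.pi * Complex.I * (a : ℂ) ^ 2 / (y : ℂ)) : ℂ) =
      ((-(Real.pi * a ^ 2 / y) : ℝ) : ℂ) * Complex.I := by push_cast; ring
  rw [this, Complex.norm_exp_ofReal_mul_I]

lemma rho_mul_add_eq_line (y u : ℝ) (k : ℕ) :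
    ρ * (y : ℂ) * (u : ℂ) + ((k : ℂ) + 1) = ((k + 1 : ℝ) : ℂ) + ρ * ((y * u : ℝ) : ℂ) := by
  push_cast; ring

lemma norm_corrTerm_le {s y : ℝ} (hs : 0 < s) (hy : 0 < y) (u : ℝ) (k : ℕ) :
    ‖corrTerm s y u k‖ ≤ corrBound s k * (y * |u|) := by
  have h1 := norm_exp_neg_div y (k + 1)
  have h2 := norm_inv_cpow_sub_le hs (show (0 : ℝ) < k + 1 by positivity) (y * u)
  rw [abs_mul, abs_of_pos hy] at h2
  rw [corrTerm, norm_mul, rho_mul_add_eq_line, corrBound]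
  push_cast at h1 h2 ⊢
  rw [h1, one_mul]
  exact h2

lemma corrBound_nonneg {s : ℝ} (hs : 0 < s) (k : ℕ) : 0 ≤ corrBound s k := by
  unfold corrBound; positivity

lemma summable_corrBound {s : ℝ} (hs : 0 < s) : Summable (corrBound s) := by
  have h1 : Summable (fun k : ℕ => ((k : ℝ) ^ (-s - 1))) :=
    Real.summable_nat_rpow.2 (by linarith)
  have h2 := ((summable_nat_add_iff 1).2 h1).mul_left (s * ((2 : ℝ) ^ (-s - 1))⁻¹)
  refine h2.congr fun k => ?_
  rw [corrBound, Real.div_rpow (by positivity) (by norm_num)]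
  push_cast
  ring

lemma summable_corrTerm {s y : ℝ} (hs : 0 < s) (hy : 0 < y) (u : ℝ) :
    Summable (corrTerm s y u) :=
  Summable.of_norm_bounded ((summable_corrBound hs).mul_right (y * |u|))
    fun k => norm_corrTerm_le hs hy u k

lemma continuous_inv_cpow (s : ℝ) (y : ℝ) (k : ℕ) :
    Continuous (fun u : ℝ => ((ρ * (y : ℂ) * (u : ℂ) + ((k : ℂ) + 1)) ^ (s : ℂ))⁻¹) := by
  simp_rw [rho_mul_add_eq_line]
  have hk : (0 : ℝ) < k + 1 := by positivity
  refine Continuous.inv₀ ?_ fun u => cpow_line_ne_zero s hk (y * u)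
  rw [continuous_iff_continuousAt]
  intro u
  exact ContinuousAt.comp (f := fun u : ℝ => ((k + 1 : ℝ) : ℂ) + ρ * ((y * u : ℝ) : ℂ))
    (differentiableAt_cpow s (line_mem_slitPlane hk (y * u))).continuousAt (by fun_prop)

lemma continuous_corrTerm (s y : ℝ) (k : ℕ) : Continuous (fun u : ℝ => corrTerm s y u k) :=
  continuous_const.mul ((continuous_inv_cpow s y k).sub continuous_const)

lemma norm_sum_corrTerm_le {s y : ℝ} (hs : 0 < s) (hy : 0 < y) (u : ℝ) (m : ℕ) :
    ‖∑ k ∈ Finset.range m, corrTerm s y u k‖ ≤ (∑' k, corrBound s k) * (y * |u|) := by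
  refine (norm_sum_le_of_le _ fun k _ => norm_corrTerm_le hs hy u k).trans ?_
  rw [← Finset.sum_mul]
  gcongr
  exact (summable_corrBound hs).sum_le_tsum _ fun k _ => corrBound_nonneg hs k

lemma norm_exp_mul_sum_corrTerm_le {s y : ℝ} (hs : 0 < s) (hy : 0 < y) (u : ℝ) (m : ℕ) :
    ‖((Real.exp (-(Real.pi * y * u ^ 2)) : ℝ) : ℂ) * ∑ k ∈ Finset.range m, corrTerm s y u k‖ ≤
      (∑' k, corrBound s k) * y * (|u| ^ (1 : ℝ) * Real.exp (-(Real.pi * y * u ^ 2))) := by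
  rw [norm_mul, Complex.norm_real, Real.norm_eq_abs, Real.abs_exp, Real.rpow_one]
  calc _ ≤ Real.exp (-(Real.pi * y * u ^ 2)) * ((∑' k, corrBound s k) * (y * |u|)) := by
        gcongr; exact norm_sum_corrTerm_le hs hy u m
    _ = _ := by ring

/-- The second integral defining `Ifun s y 0`, with the series truncated at `m` terms. -/
def corrInt (s y : ℝ) (m : ℕ) : ℂ :=
  ∫ u : ℝ, ((Real.exp (-(Real.pi * y * u ^ 2)) : ℝ) : ℂ) *
    ∑ k ∈ Finset.range m, corrTerm s y u k

lemma continuous_exp_mul_sum_corrTerm (s y : ℝ) (m : ℕ) :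
    Continuous (fun u : ℝ => ((Real.exp (-(Real.pi * y * u ^ 2)) : ℝ) : ℂ) *
      ∑ k ∈ Finset.range m, corrTerm s y u k) :=
  (by fun_prop : Continuous fun u : ℝ => ((Real.exp (-(Real.pi * y * u ^ 2)) : ℝ) : ℂ)).mul
    (continuous_finsetSum _ fun k _ => continuous_corrTerm s y k)

lemma integrable_corrInt {s y : ℝ} (hs : 0 < s) (hy : 0 < y) (m : ℕ) :
    Integrable (fun u : ℝ => ((Real.exp (-(Real.pi * y * u ^ 2)) : ℝ) : ℂ) *
      ∑ k ∈ Finset.range m, corrTerm s y u k) :=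
  Integrable.mono' ((integrable_integral_abs_rpow_mul_exp (by norm_num : (-1 : ℝ) < 1)
    hy).1.const_mul _) (continuous_exp_mul_sum_corrTerm s y m).aestronglyMeasurable
    (Filter.Eventually.of_forall fun u => norm_exp_mul_sum_corrTerm_le hs hy u m)

lemma norm_corrInt_le {s y : ℝ} (hs : 0 < s) (hy : 0 < y) (m : ℕ) :
    ‖corrInt s y m‖ ≤ ∑' k, corrBound s k := by
  obtain ⟨hi, hv⟩ := integrable_integral_abs_rpow_mul_exp (by norm_num : (-1 : ℝ) < 1) hy
  have h := norm_integral_le_of_norm_le (hi.const_mul ((∑' k, corrBound s k) * y))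
    (Filter.Eventually.of_forall fun u => norm_exp_mul_sum_corrTerm_le hs hy u m)
  refine h.trans ?_
  have hS : 0 ≤ ∑' k, corrBound s k := tsum_nonneg (corrBound_nonneg hs)
  have e : (Real.pi * y) ^ (-(1 + 1) / 2 : ℝ) = (Real.pi * y)⁻¹ := by
    rw [← Real.rpow_neg_one]; norm_num
  rw [integral_const_mul, hv, e]
  norm_num
  have hpi : Real.pi⁻¹ ≤ 1 := inv_le_one_of_one_le₀ (by linarith [Real.pi_gt_three])
  calc _ = (∑' k, corrBound s k) * Real.pi⁻¹ := by field_simp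
    _ ≤ _ := mul_le_of_le_one_right hS hpi

lemma tendsto_corrInt {s y : ℝ} (hs : 0 < s) (hy : 0 < y) :
    Tendsto (corrInt s y) atTop (𝓝 (∫ u : ℝ, ((Real.exp (-(Real.pi * y * u ^ 2)) : ℝ) : ℂ) *
      ∑' k, corrTerm s y u k)) := by
  refine tendsto_integral_of_dominated_convergence _
    (fun m => (continuous_exp_mul_sum_corrTerm s y m).aestronglyMeasurable)
    ((integrable_integral_abs_rpow_mul_exp (by norm_num : (-1 : ℝ) < 1) hy).1.const_mul
      ((∑' k, corrBound s k) * y))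
    (fun m => Filter.Eventually.of_forall fun u => norm_exp_mul_sum_corrTerm_le hs hy u m)
    (Filter.Eventually.of_forall fun u => ?_)
  exact ((summable_corrTerm hs hy u).hasSum.tendsto_sum_nat).const_mul _

lemma Ifun_zero (s y : ℝ) : Ifun s y 0 = ρ * lineRem s y 0 0 +
    ρ * (y : ℂ) ^ (s : ℂ) * ∫ u : ℝ, ((Real.exp (-(Real.pi * y * u ^ 2)) : ℝ) : ℂ) *
      ∑' k, corrTerm s y u k := by
  rw [Ifun, integral_const_mul, lineRem]
  simp only [Int.fract_zero, Complex.ofReal_zero, mul_zero, sub_zero, add_zero, corrTerm,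
    poleKernel, quadExp, oneSubExp]
  congr 3
  funext u
  have e : (((0 : ℕ) + 1 / 2 : ℝ) : ℂ) = 1 / 2 := by push_cast; ring
  rw [e]
  congr 2
  push_cast; ring

/-! ### The approximate functional equation -/

lemma corrInt_succ {s y : ℝ} (hs : 0 < s) (hy : 0 < y) (m : ℕ) :
    corrInt s y (m + 1) = corrInt s y m + ∫ u : ℝ,
      ((Real.exp (-(Real.pi * y * u ^ 2)) : ℝ) : ℂ) * corrTerm s y u m := by
  have e : ∀ u : ℝ, ((Real.exp (-(Real.pi * y * u ^ 2)) : ℝ) : ℂ) * corrTerm s y u m =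
      ((Real.exp (-(Real.pi * y * u ^ 2)) : ℝ) : ℂ) *
        (∑ k ∈ Finset.range (m + 1), corrTerm s y u k) -
      ((Real.exp (-(Real.pi * y * u ^ 2)) : ℝ) : ℂ) *
        ∑ k ∈ Finset.range m, corrTerm s y u k := by
    intro u; rw [Finset.sum_range_succ]; ring
  simp_rw [e]
  rw [integral_sub (integrable_corrInt hs hy (m + 1)) (integrable_corrInt hs hy m), corrInt,
    corrInt]
  ring

lemma integral_corrTerm {s y : ℝ} (hs : 0 < s) (hy : 0 < y) (m : ℕ) :
    ∫ u : ℝ, ((Real.exp (-(Real.pi * y * u ^ 2)) : ℝ) : ℂ) * corrTerm s y u m =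
      Complex.exp (-(Real.pi * Complex.I * ((m + 1 : ℕ) : ℂ) ^ 2 / (y : ℂ))) *
        ((∫ u : ℝ, ((Real.exp (-(Real.pi * y * u ^ 2)) : ℝ) : ℂ) *
          ((ρ * (y : ℂ) * (u : ℂ) + (m + 1 : ℕ)) ^ (s : ℂ))⁻¹) -
        ((y ^ (-(1 / 2) : ℝ) : ℝ) : ℂ) * (((m + 1 : ℕ) : ℂ) ^ (s : ℂ))⁻¹) := by
  set E := Complex.exp (-(Real.pi * Complex.I * ((m + 1 : ℕ) : ℂ) ^ 2 / (y : ℂ))) with hE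
  have hE0 : E ≠ 0 := Complex.exp_ne_zero _
  have i1 : Integrable (fun u : ℝ => ((Real.exp (-(Real.pi * y * u ^ 2)) : ℝ) : ℂ) *
      corrTerm s y u m) := by
    have := (integrable_corrInt hs hy (m + 1)).sub (integrable_corrInt hs hy m)
    refine this.congr (Filter.Eventually.of_forall fun u => ?_)
    simp only [Pi.sub_apply, Finset.sum_range_succ]
    ring
  have i2 : Integrable (fun u : ℝ => ((Real.exp (-(Real.pi * y * u ^ 2)) : ℝ) : ℂ) *
      (((m + 1 : ℕ) : ℂ) ^ (s : ℂ))⁻¹) :=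
    (integrable_exp_neg_pi_mul hy).ofReal.mul_const _
  have e : ∀ u : ℝ, ((Real.exp (-(Real.pi * y * u ^ 2)) : ℝ) : ℂ) *
          ((ρ * (y : ℂ) * (u : ℂ) + (m + 1 : ℕ)) ^ (s : ℂ))⁻¹ =
      E⁻¹ * (((Real.exp (-(Real.pi * y * u ^ 2)) : ℝ) : ℂ) * corrTerm s y u m) +
      ((Real.exp (-(Real.pi * y * u ^ 2)) : ℝ) : ℂ) * (((m + 1 : ℕ) : ℂ) ^ (s : ℂ))⁻¹ := by
    intro u
    have : corrTerm s y u m = E * (((ρ * (y : ℂ) * (u : ℂ) + (m + 1 : ℕ)) ^ (s : ℂ))⁻¹ -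
        (((m + 1 : ℕ) : ℂ) ^ (s : ℂ))⁻¹) := by
      rw [corrTerm, hE]; push_cast; rfl
    rw [this]
    field_simp
    ring
  simp_rw [e]
  rw [integral_add (i1.const_mul _) i2, integral_const_mul, integral_mul_const,
    integral_complex_ofReal, integral_exp_neg_pi_mul hy]
  field_simp
  ring

lemma Fpart_succ (s : ℝ) (n : ℕ) (x : ℝ) :
    Fpart s (n + 1) x 0 = Fpart s n x 0 +
      Complex.exp (Real.pi * Complex.I * ((n + 1 : ℕ) : ℂ) ^ 2 * (x : ℂ)) /
        ((n + 1 : ℕ) : ℂ) ^ (s : ℂ) := by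
  rw [Fpart, Fpart, Finset.sum_Icc_succ_top (by omega)]
  simp

lemma Fpart_eq_lineRem {s y : ℝ} (hs : 0 < s) (hy : 0 < y) (n : ℕ) :
    Fpart s n y 0 = ρ * lineRem s y 0 0 - ρ * lineRem s y 0 n := by
  induction n with
  | zero => simp [Fpart]
  | succ n ih =>
    rw [Fpart_succ, ih]
    have := rho_mul_lineRem_sub hs hy n
    have e : powKernel s y 0 ((n + 1 : ℕ) : ℂ) =
        Complex.exp (Real.pi * Complex.I * ((n + 1 : ℕ) : ℂ) ^ 2 * (y : ℂ)) /
        ((n + 1 : ℕ) : ℂ) ^ (s : ℂ) := by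
      rw [powKernel, quadExp]
      congr 2
      push_cast; ring
    rw [e] at this
    linear_combination -this

lemma lineRem_eq_Fpart {s y : ℝ} (hs : 0 < s) (hy : 0 < y) (m n : ℕ) :
    ρ * lineRem s y 0 n = ρ * lineRem s y m n - ρ * (y : ℂ) ^ (s : ℂ) * corrInt s y m -
      ρ * ((y ^ (s - 1 / 2) : ℝ) : ℂ) * Fpart s m (-1 / y) 0 := by
  induction m with
  | zero => simp [Fpart, corrInt]
  | succ m ih =>
    have h1 := lineRem_succ hs hy m n
    rw [ih, Fpart_succ, corrInt_succ hs hy, integral_corrTerm hs hy]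
    have e : Complex.exp (Real.pi * Complex.I * ((m + 1 : ℕ) : ℂ) ^ 2 * ((-1 / y : ℝ) : ℂ)) =
        Complex.exp (-(Real.pi * Complex.I * ((m + 1 : ℕ) : ℂ) ^ 2 / (y : ℂ))) := by
      congr 1; push_cast; ring
    have e2 : ((y ^ (s - 1 / 2) : ℝ) : ℂ) =
        (y : ℂ) ^ (s : ℂ) * ((y ^ (-(1 / 2) : ℝ) : ℝ) : ℂ) := by
      rw [sub_eq_add_neg, Real.rpow_add hy, Complex.ofReal_mul, Complex.ofReal_cpow hy.le s]
    rw [e, e2, div_eq_mul_inv]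
    linear_combination ρ * h1

lemma approx_functional_eq {s y : ℝ} (hs : 0 < s) (hy : 0 < y) (m n : ℕ) :
    Fpart s n y 0 - ρ * ((y ^ (s - 1 / 2) : ℝ) : ℂ) * Fpart s m (-1 / y) 0 =
      ρ * lineRem s y 0 0 + ρ * (y : ℂ) ^ (s : ℂ) * corrInt s y m - ρ * lineRem s y m n := by
  rw [Fpart_eq_lineRem hs hy, lineRem_eq_Fpart hs hy m n]
  ring

/-! ### Bounds for the remainder -/

lemma norm_poleKernel_le {s y : ℝ} {m n : ℕ} (h0 : 0 ≤ y * (n + 1 / 2) - m)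
    (h1 : y * (n + 1 / 2) - m ≤ 1) {B u : ℝ} (hB : 0 < B)
    (hle : B ≤ ‖(((n + 1 / 2 : ℝ) : ℂ) + ρ * u) ^ (s : ℂ)‖) :
    ‖poleKernel s y m ((n + 1 / 2 : ℝ) + ρ * u)‖ ≤
      2 / B * Real.exp (-(Real.pi * y * u ^ 2)) := by
  set E := Real.exp (-(2 * Real.pi * (√2 / 2) * u) * (y * (n + 1 / 2) - m)) with hE
  have hE0 : 0 < E := Real.exp_pos _
  have h2 := exp_le_norm_oneSubExp n u h0 h1
  have h3 : ‖quadExp y (-2 * m) ((n + 1 / 2 : ℝ) + ρ * u)‖ =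
      Real.exp (-(Real.pi * y * u ^ 2)) * E := by
    rw [norm_quadExp_line, hE, ← Real.exp_add]
    congr 1; ring
  rw [poleKernel, norm_div, norm_mul, h3]
  calc _ ≤ Real.exp (-(Real.pi * y * u ^ 2)) * E / (B * (1 / 2 * E)) := by gcongr
    _ = _ := by field_simp

lemma norm_lineRem_le_of_index {s y : ℝ} (hs : 0 < s) (hy : 0 < y) {m n : ℕ}
    (h0 : 0 ≤ y * (n + 1 / 2) - m) (h1 : y * (n + 1 / 2) - m ≤ 1) :
    ‖lineRem s y m n‖ ≤ 2 / (((n : ℝ) + 1 / 2) / 2) ^ s * y ^ (-(1 / 2) : ℝ) := by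
  have hc : (0 : ℝ) < n + 1 / 2 := by positivity
  have h := norm_integral_le_of_norm_le
    ((integrable_exp_neg_pi_mul hy).const_mul (2 / (((n : ℝ) + 1 / 2) / 2) ^ s))
    (Filter.Eventually.of_forall fun u => norm_poleKernel_le (s := s) (u := u) h0 h1
      (by positivity) (rpow_le_norm_cpow_line hs hc u))
  rwa [integral_const_mul, integral_exp_neg_pi_mul hy] at h

/-- The constant in `norm_lineRem_le`. -/
def lineConst (s : ℝ) : ℝ :=
  2 * 2 ^ s * (Real.pi ^ (-((1 - s) / 2)) * Real.Gamma ((1 - s) / 2))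

lemma norm_lineRem_le {s y : ℝ} (hs : 0 < s) (hs' : s < 1) (hy : 0 < y) {m n : ℕ}
    (h0 : 0 ≤ y * (n + 1 / 2) - m) (h1 : y * (n + 1 / 2) - m ≤ 1) :
    ‖lineRem s y m n‖ ≤ lineConst s / y ^ ((1 - s) / 2) := by
  obtain ⟨hi, hv⟩ := integrable_integral_abs_rpow_mul_exp (by linarith : -1 < -s) hy
  have hae : ∀ᵐ u : ℝ, ‖poleKernel s y m ((n + 1 / 2 : ℝ) + ρ * u)‖ ≤
      2 * 2 ^ s * (|u| ^ (-s) * Real.exp (-(Real.pi * y * u ^ 2))) := by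
    filter_upwards [(measure_eq_zero_iff_ae_notMem.1 (measure_singleton (0 : ℝ)))] with u hu
    have hu0 : 0 < |u| := abs_pos.2 (by simpa using hu)
    have hle : (|u| / 2) ^ s ≤ ‖(((n + 1 / 2 : ℝ) : ℂ) + ρ * u) ^ (s : ℂ)‖ := by
      rw [Complex.norm_cpow_real]
      exact Real.rpow_le_rpow (by positivity) (half_abs_le_norm_line _ u) hs.le
    refine (norm_poleKernel_le h0 h1 (by positivity) hle).trans_eq ?_
    rw [Real.div_rpow hu0.le (by norm_num), Real.rpow_neg hu0.le]
    field_simp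
  have h := norm_integral_le_of_norm_le (hi.const_mul (2 * 2 ^ s)) hae
  rw [integral_const_mul, hv] at h
  refine h.trans_eq ?_
  have e : -(-s + 1) / 2 = -((1 - s) / 2) := by ring
  have e' : (-s + 1) / 2 = (1 - s) / 2 := by ring
  rw [e, e', Real.mul_rpow Real.pi_pos.le hy.le, Real.rpow_neg hy.le, lineConst]
  ring

lemma tendsto_lineRem {s y : ℝ} (hs : 0 < s) (hy : 0 < y) {m : ℕ → ℕ}
    (h0 : ∀ n, 0 ≤ y * (n + 1 / 2) - m n) (h1 : ∀ n, y * (n + 1 / 2) - m n ≤ 1) :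
    Tendsto (fun n => lineRem s y (m n) n) atTop (𝓝 0) := by
  refine squeeze_zero_norm (fun n => norm_lineRem_le_of_index hs hy (h0 n) (h1 n)) ?_
  have t1 : Tendsto (fun n : ℕ => ((n : ℝ) + 1 / 2) / 2) atTop atTop :=
    (tendsto_atTop_add_const_right _ _ tendsto_natCast_atTop_atTop).atTop_div_const two_pos
  have t2 := (((tendsto_rpow_atTop hs).comp t1).const_div_atTop 2).mul_const (y ^ (-(1 / 2) : ℝ))
  simpa using t2

/-! ### One step of the renormalisation -/

/-- The index `⌊|x|(n + 1/2)⌋` of the partial sum dual to the `n`-th one. -/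
def dualIndex (x : ℝ) (n : ℕ) : ℕ := ⌊|x| * (n + 1 / 2)⌋₊

/-- The difference between a partial sum at `x` and its dual partial sum at `T(x)`. -/
def renormDiff (s : ℝ) (n : ℕ) (x : ℝ) : ℂ :=
  Fpart s n x 0 - Complex.exp (Real.pi * Complex.I / 4 * (Real.sign x : ℂ)) *
    ((|x| ^ (s - 1 / 2) : ℝ) : ℂ) * Fpart s (dualIndex x n) (Tmap x) 0

lemma dualIndex_le {x : ℝ} (hx : |x| ≤ 1) (n : ℕ) : dualIndex x n ≤ n := by
  have h : |x| * (n + 1 / 2) < (n + 1 : ℕ) := by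
    push_cast
    nlinarith [abs_nonneg x, (Nat.cast_nonneg n : (0 : ℝ) ≤ n)]
  exact Nat.lt_succ_iff.1 ((Nat.floor_lt' (by omega)).2 h)

lemma tendsto_dualIndex {x : ℝ} (hx : x ≠ 0) : Tendsto (dualIndex x) atTop atTop :=
  tendsto_nat_floor_atTop.comp
    ((tendsto_atTop_add_const_right _ _ tendsto_natCast_atTop_atTop).const_mul_atTop
      (abs_pos.2 hx))

lemma sub_dualIndex_mem {y : ℝ} (hy : 0 < y) (n : ℕ) :
    0 ≤ y * (n + 1 / 2) - dualIndex y n ∧ y * (n + 1 / 2) - dualIndex y n ≤ 1 := by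
  rw [dualIndex, abs_of_pos hy]
  have h : 0 ≤ y * (n + 1 / 2) := by positivity
  exact ⟨sub_nonneg.2 (Nat.floor_le h), by linarith [Nat.lt_floor_add_one (y * (n + 1 / 2))]⟩

lemma Fpart_neg (s : ℝ) (n : ℕ) (x : ℝ) :
    Fpart s n (-x) 0 = (starRingEnd ℂ) (Fpart s n x 0) := by
  rw [Fpart, Fpart, map_sum]
  refine Finset.sum_congr rfl fun k _ => ?_
  have e : (k : ℂ) ^ (s : ℂ) = (((k : ℝ) ^ s : ℝ) : ℂ) := by
    rw [Complex.ofReal_cpow (Nat.cast_nonneg k)]; simp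
  rw [e, map_div₀, Complex.conj_ofReal, ← Complex.exp_conj]
  simp

lemma Fpart_add_two_mul_int (s : ℝ) (n : ℕ) (x : ℝ) (c : ℤ) :
    Fpart s n (x + 2 * c) 0 = Fpart s n x 0 := by
  rw [Fpart, Fpart]
  refine Finset.sum_congr rfl fun k _ => ?_
  congr 1
  rw [Complex.exp_eq_exp_iff_exists_int]
  refine ⟨(k : ℤ) ^ 2 * c, ?_⟩
  push_cast
  ring

lemma Fpart_Tmap (s : ℝ) (n : ℕ) (x : ℝ) : Fpart s n (Tmap x) 0 = Fpart s n (-1 / x) 0 := by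
  have e : Tmap x = -1 / x + 2 * ((-⌈((-1 / x) - 1) / 2⌉ : ℤ) : ℝ) := by
    rw [Tmap]; push_cast; ring
  rw [e, Fpart_add_two_mul_int]

lemma renormDiff_neg (s : ℝ) (n : ℕ) (x : ℝ) :
    renormDiff s n (-x) = (starRingEnd ℂ) (renormDiff s n x) := by
  have e : (-1 / -x : ℝ) = -(-1 / x) := by ring
  have e2 : dualIndex (-x) n = dualIndex x n := by rw [dualIndex, dualIndex, abs_neg]
  rw [renormDiff, renormDiff, Fpart_Tmap, Fpart_Tmap, e, Fpart_neg, Fpart_neg, abs_neg, e2,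
    map_sub, map_mul, map_mul, Complex.conj_ofReal, ← Complex.exp_conj, Real.sign_neg]
  congr 4
  simp only [map_mul, map_div₀, Complex.conj_ofReal, Complex.conj_I, map_ofNat]
  push_cast
  ring

lemma renormDiff_of_pos {s y : ℝ} (hs : 0 < s) (hy : 0 < y) (n : ℕ) :
    renormDiff s n y = ρ * lineRem s y 0 0 + ρ * (y : ℂ) ^ (s : ℂ) * corrInt s y (dualIndex y n) -
      ρ * lineRem s y (dualIndex y n) n := by
  rw [← approx_functional_eq hs hy, renormDiff, Fpart_Tmap, Real.sign_of_pos hy, abs_of_pos hy, ρ]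
  simp

/-- The constant in `norm_renormDiff_le`. -/
def renormConst (s : ℝ) : ℝ := 2 * lineConst s + ∑' k, corrBound s k

lemma norm_renormDiff_le {s x : ℝ} (hs : 0 < s) (hs' : s < 1) (hx : |x| ≤ 1) (hx0 : x ≠ 0)
    (n : ℕ) : ‖renormDiff s n x‖ ≤ renormConst s / |x| ^ ((1 - s) / 2) := by
  wlog hpos : 0 < x generalizing x
  · have := this (x := -x) (by simpa) (by simpa)
      (neg_pos.2 (lt_of_le_of_ne (not_lt.1 hpos) hx0))
    rwa [renormDiff_neg, Complex.norm_conj, abs_neg] at this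
  rw [abs_of_pos hpos] at hx ⊢
  obtain ⟨h0, h1⟩ := sub_dualIndex_mem hpos n
  have b1 := norm_lineRem_le hs hs' hpos h0 h1
  have b2 : ‖lineRem s x 0 0‖ ≤ lineConst s / x ^ ((1 - s) / 2) :=
    norm_lineRem_le hs hs' hpos (by push_cast; linarith) (by push_cast; linarith)
  have b3 : ‖(x : ℂ) ^ (s : ℂ) * corrInt s x (dualIndex x n)‖ ≤
      (∑' k, corrBound s k) / x ^ ((1 - s) / 2) := by
    have hS : 0 ≤ ∑' k, corrBound s k := tsum_nonneg (corrBound_nonneg hs)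
    rw [norm_mul, Complex.norm_cpow_real, Complex.norm_real, Real.norm_eq_abs, abs_of_pos hpos,
      le_div_iff₀ (by positivity)]
    calc _ ≤ 1 * (∑' k, corrBound s k) * 1 := by
          gcongr
          · exact Real.rpow_le_one hpos.le hx hs.le
          · exact norm_corrInt_le hs hpos _
          · exact Real.rpow_le_one hpos.le hx (by linarith)
      _ = _ := by ring
  rw [renormDiff_of_pos hs hpos, mul_assoc, ← mul_add, ← mul_sub, norm_mul, norm_rho, one_mul]
  refine (norm_sub_le _ _).trans ((add_le_add (norm_add_le _ _) le_rfl).trans ?_)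
  rw [renormConst, add_div, mul_div_assoc]
  linarith

lemma Omega0_neg_of_pos {s x : ℝ} (hx : 0 < x) :
    Omega0 s (-x) = (starRingEnd ℂ) (Omega0 s x) := by
  rw [Omega0, Omega0, Omega, Omega, if_pos hx, if_neg (by linarith), neg_neg, neg_zero]

lemma tendsto_renormDiff {s x : ℝ} (hs : 0 < s) (hx0 : x ≠ 0) :
    Tendsto (fun n => renormDiff s n x) atTop (𝓝 (Omega0 s x)) := by
  wlog hpos : 0 < x generalizing x
  · have hx : 0 < -x := neg_pos.2 (lt_of_le_of_ne (not_lt.1 hpos) hx0)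
    have h := (Complex.continuous_conj.tendsto _).comp (this (x := -x) (by simpa) hx)
    rw [← Omega0_neg_of_pos hx, neg_neg] at h
    refine h.congr fun n => ?_
    rw [Function.comp_apply, ← renormDiff_neg, neg_neg]
  simp_rw [renormDiff_of_pos hs hpos]
  have t1 := (tendsto_corrInt hs hpos).comp (tendsto_dualIndex hx0)
  have t2 := tendsto_lineRem hs hpos (fun n => (sub_dualIndex_mem hpos n).1)
    (fun n => (sub_dualIndex_mem hpos n).2)
  have t3 := ((t1.const_mul (ρ * (x : ℂ) ^ (s : ℂ))).const_add (ρ * lineRem s x 0 0)).sub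
    (t2.const_mul ρ)
  rw [mul_zero, sub_zero, ← Ifun_zero] at t3
  rw [Omega0, Omega, if_pos hpos]
  exact t3

/-! ### The orbit of `T` -/

lemma Tmap_mem_Ioc (x : ℝ) : Tmap x ∈ Set.Ioc (-1 : ℝ) 1 := by
  have h1 := Int.le_ceil (((-1 / x) - 1) / 2)
  have h2 := Int.ceil_lt_add_one (((-1 / x) - 1) / 2)
  rw [Tmap]
  constructor <;> linarith

lemma irrational_Tmap {x : ℝ} (hx : Irrational x) : Irrational (Tmap x) := by
  have h : Irrational (-1 / x) := by
    have := hx.inv.neg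
    rwa [neg_div, one_div]
  have := h.sub_intCast (2 * ⌈((-1 / x) - 1) / 2⌉)
  rw [Tmap]
  push_cast at this
  exact this

lemma irrational_iterate_Tmap {x : ℝ} (hx : Irrational x) (j : ℕ) : Irrational (Tmap^[j] x) := by
  induction j with
  | zero => exact hx
  | succ j ih => rw [Function.iterate_succ_apply']; exact irrational_Tmap ih

lemma abs_iterate_Tmap_le_one {x : ℝ} (hx : |x| ≤ 1) (j : ℕ) : |Tmap^[j] x| ≤ 1 := by
  cases j with
  | zero => exact hx
  | succ j =>
    rw [Function.iterate_succ_apply']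
    obtain ⟨h1, h2⟩ := Tmap_mem_Ioc (Tmap^[j] x)
    exact abs_le.2 ⟨h1.le, h2⟩

/-- The lengths of the partial sums obtained from the `N`-th one by iterating `dualIndex`. -/
def orbitIndex (x : ℝ) (N : ℕ) : ℕ → ℕ
  | 0 => N
  | j + 1 => dualIndex (Tmap^[j] x) (orbitIndex x N j)

/-- The coefficient of `Omega0 s (Tmap^[j] x)` in the expansion. -/
def orbitCoeff (s x : ℝ) (j : ℕ) : ℂ :=
  Complex.exp (Real.pi * Complex.I / 4
      * ((∑ ℓ ∈ Finset.range j, Real.sign (Tmap^[ℓ] x) : ℝ) : ℂ))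
    * (((∏ ℓ ∈ Finset.range j, |Tmap^[ℓ] x|) ^ (s - 1 / 2) : ℝ) : ℂ)

lemma orbitCoeff_zero (s x : ℝ) : orbitCoeff s x 0 = 1 := by simp [orbitCoeff]

lemma orbitCoeff_succ (s x : ℝ) (j : ℕ) : orbitCoeff s x (j + 1) = orbitCoeff s x j *
    (Complex.exp (Real.pi * Complex.I / 4 * (Real.sign (Tmap^[j] x) : ℂ)) *
      ((|Tmap^[j] x| ^ (s - 1 / 2) : ℝ) : ℂ)) := by
  rw [orbitCoeff, orbitCoeff, Finset.sum_range_succ, Finset.prod_range_succ,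
    Real.mul_rpow (Finset.prod_nonneg fun _ _ => abs_nonneg _) (abs_nonneg _),
    Complex.ofReal_add, mul_add, Complex.exp_add, Complex.ofReal_mul]
  ring

lemma norm_orbitCoeff (s x : ℝ) (j : ℕ) :
    ‖orbitCoeff s x j‖ = (∏ ℓ ∈ Finset.range j, |Tmap^[ℓ] x|) ^ (s - 1 / 2) := by
  have e : ∀ r : ℝ, (Real.pi * Complex.I / 4 * (r : ℂ) : ℂ) =
      ((Real.pi / 4 * r : ℝ) : ℂ) * Complex.I := fun r => by push_cast; ring
  rw [orbitCoeff, norm_mul, e, Complex.norm_exp_ofReal_mul_I, one_mul, Complex.norm_real,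
    Real.norm_of_nonneg]
  exact Real.rpow_nonneg (Finset.prod_nonneg fun _ _ => abs_nonneg _) _

lemma orbitIndex_le {x : ℝ} (hx : |x| ≤ 1) (N j : ℕ) : orbitIndex x N j ≤ N := by
  induction j with
  | zero => exact le_rfl
  | succ j ih => exact (dualIndex_le (abs_iterate_Tmap_le_one hx j) _).trans ih

lemma tendsto_orbitIndex {x : ℝ} (hx : Irrational x) (j : ℕ) :
    Tendsto (fun N => orbitIndex x N j) atTop atTop := by
  induction j with
  | zero => exact tendsto_id
  | succ j ih => exact (tendsto_dualIndex (irrational_iterate_Tmap hx j).ne_zero).comp ih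

lemma Fpart_eq_sum_range_add (s x : ℝ) (N J : ℕ) : Fpart s N x 0 =
    ∑ j ∈ Finset.range J, orbitCoeff s x j * renormDiff s (orbitIndex x N j) (Tmap^[j] x) +
      orbitCoeff s x J * Fpart s (orbitIndex x N J) (Tmap^[J] x) 0 := by
  induction J with
  | zero => simp [orbitCoeff_zero, orbitIndex]
  | succ J ih =>
    rw [ih, Finset.sum_range_succ, orbitCoeff_succ, Function.iterate_succ_apply', orbitIndex,
      renormDiff]
    ring

lemma norm_Fpart_le {s : ℝ} (hs : 0 < s) (n : ℕ) (x : ℝ) : ‖Fpart s n x 0‖ ≤ n := by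
  induction n with
  | zero => simp [Fpart]
  | succ n ih =>
    rw [Fpart_succ]
    refine (norm_add_le _ _).trans ?_
    have e : (Real.pi * Complex.I * ((n + 1 : ℕ) : ℂ) ^ 2 * (x : ℂ) : ℂ) =
      ((Real.pi * (n + 1 : ℕ) ^ 2 * x : ℝ) : ℂ) * Complex.I := by push_cast; ring
    have h1 : 1 ≤ ‖((n + 1 : ℕ) : ℂ) ^ (s : ℂ)‖ := by
      rw [Complex.norm_cpow_real, Complex.norm_natCast]
      exact Real.one_le_rpow (by push_cast; linarith [(Nat.cast_nonneg n : (0 : ℝ) ≤ n)]) hs.le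
    rw [norm_div, e, Complex.norm_exp_ofReal_mul_I]
    push_cast at h1 ⊢
    exact add_le_add ih (div_le_one_of_le₀ h1 (norm_nonneg _))

lemma norm_orbitCoeff_mul_renormDiff_le {s x : ℝ} (hs : 0 < s) (hs' : s < 1) (hx : |x| ≤ 1)
    (hirr : Irrational x) (j n : ℕ) :
    ‖orbitCoeff s x j * renormDiff s n (Tmap^[j] x)‖ ≤ renormConst s *
      ((∏ ℓ ∈ Finset.range j, |Tmap^[ℓ] x|) ^ (s - 1 / 2) / |Tmap^[j] x| ^ ((1 - s) / 2)) := by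
  rw [norm_mul, norm_orbitCoeff, mul_div_left_comm]
  exact mul_le_mul_of_nonneg_left (norm_renormDiff_le hs hs' (abs_iterate_Tmap_le_one hx j)
    (irrational_iterate_Tmap hirr j).ne_zero n)
    (Real.rpow_nonneg (Finset.prod_nonneg fun _ _ => abs_nonneg _) _)

lemma hasSum_orbitCoeff_mul_renormDiff {s x : ℝ} (hs : 0 < s) (hs' : s < 1) (hx : |x| ≤ 1)
    (hirr : Irrational x) (hsum : Summable (fun j : ℕ =>
      (∏ ℓ ∈ Finset.range j, |Tmap^[ℓ] x|) ^ (s - 1 / 2) / |Tmap^[j] x| ^ ((1 - s) / 2)))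
    (N : ℕ) :
    HasSum (fun j => orbitCoeff s x j * renormDiff s (orbitIndex x N j) (Tmap^[j] x))
      (Fpart s N x 0) := by
  have hsm : Summable
      (fun j => orbitCoeff s x j * renormDiff s (orbitIndex x N j) (Tmap^[j] x)) :=
    Summable.of_norm_bounded (hsum.mul_left (renormConst s))
      fun j => norm_orbitCoeff_mul_renormDiff_le hs hs' hx hirr j _
  have h0 : Tendsto (fun J => orbitCoeff s x J * Fpart s (orbitIndex x N J) (Tmap^[J] x) 0)
      atTop (𝓝 0) := by
    have hz := hsum.tendsto_atTop_zero.mul_const (N : ℝ)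
    rw [zero_mul] at hz
    refine squeeze_zero_norm (fun J => ?_) hz
    rw [norm_mul, norm_orbitCoeff]
    have hxJ : 0 < |Tmap^[J] x| := abs_pos.2 (irrational_iterate_Tmap hirr J).ne_zero
    have hP : 0 ≤ (∏ ℓ ∈ Finset.range J, |Tmap^[ℓ] x|) ^ (s - 1 / 2) :=
      Real.rpow_nonneg (Finset.prod_nonneg fun _ _ => abs_nonneg _) _
    have hle : |Tmap^[J] x| ^ ((1 - s) / 2) ≤ 1 :=
      Real.rpow_le_one hxJ.le (abs_iterate_Tmap_le_one hx J) (by linarith)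
    exact mul_le_mul (le_div_self hP (Real.rpow_pos_of_pos hxJ _) hle)
      ((norm_Fpart_le hs _ _).trans (by exact_mod_cast orbitIndex_le hx N J))
      (norm_nonneg _) (by positivity)
  have h1 : Tendsto (fun J => ∑ j ∈ Finset.range J,
      orbitCoeff s x j * renormDiff s (orbitIndex x N j) (Tmap^[j] x)) atTop
      (𝓝 (Fpart s N x 0)) := by
    have := (tendsto_const_nhds (x := Fpart s N x 0)).sub h0
    rw [sub_zero] at this
    refine this.congr fun J => ?_
    rw [Fpart_eq_sum_range_add s x N J]
    ring
  exact (hsm.hasSum_iff_tendsto_nat).2 h1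

lemma norm_orbitCoeff_mul_Omega0_le {s x : ℝ} (hs : 0 < s) (hs' : s < 1) (hx : |x| ≤ 1)
    (hirr : Irrational x) (j : ℕ) :
    ‖orbitCoeff s x j * Omega0 s (Tmap^[j] x)‖ ≤ renormConst s *
      ((∏ ℓ ∈ Finset.range j, |Tmap^[ℓ] x|) ^ (s - 1 / 2) / |Tmap^[j] x| ^ ((1 - s) / 2)) :=
  le_of_tendsto ((tendsto_renormDiff hs (irrational_iterate_Tmap hirr j).ne_zero).const_mul
    (orbitCoeff s x j)).norm
    (Filter.Eventually.of_forall fun n => norm_orbitCoeff_mul_renormDiff_le hs hs' hx hirr j n)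

lemma tendsto_Fpart {s x : ℝ} (hs : 0 < s) (hs' : s < 1) (hx : |x| ≤ 1)
    (hirr : Irrational x) (hsum : Summable (fun j : ℕ =>
      (∏ ℓ ∈ Finset.range j, |Tmap^[ℓ] x|) ^ (s - 1 / 2) / |Tmap^[j] x| ^ ((1 - s) / 2))) :
    Tendsto (fun N => Fpart s N x 0) atTop
      (𝓝 (∑' j, orbitCoeff s x j * Omega0 s (Tmap^[j] x))) := by
  simp_rw [← (hasSum_orbitCoeff_mul_renormDiff hs hs' hx hirr hsum _).tsum_eq]
  exact tendsto_tsum_of_dominated_convergence (hsum.mul_left (renormConst s))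
    (fun j => ((tendsto_renormDiff hs (irrational_iterate_Tmap hirr j).ne_zero).comp
      (tendsto_orbitIndex hirr j)).const_mul _)
    (Filter.Eventually.of_forall fun N j =>
      norm_orbitCoeff_mul_renormDiff_le hs hs' hx hirr j _)

end

/-- convergence of `F_s(x)` and the `T`-expansion, `1/2 < s < 1`. -/
theorem stmt10 (s : ℝ) (hs1 : 1 / 2 < s) (hs2 : s < 1)
    (x : ℝ) (hx : x ∈ Set.Ioo (-1 : ℝ) 1) (hirr : Irrational x)
    (hsum : Summable (fun j : ℕ =>
      (∏ ℓ ∈ Finset.range j, |Tmap^[ℓ] x|) ^ (s - 1 / 2) / |Tmap^[j] x| ^ ((1 - s) / 2))) :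
    ∃ L : ℂ, Tendsto (fun n : ℕ => Fpart s n x 0) atTop (𝓝 L) ∧
      HasSum (fun j : ℕ =>
        Complex.exp (Real.pi * Complex.I / 4
            * ((∑ ℓ ∈ Finset.range j, Real.sign (Tmap^[ℓ] x) : ℝ) : ℂ))
          * (((∏ ℓ ∈ Finset.range j, |Tmap^[ℓ] x|) ^ (s - 1 / 2) : ℝ) : ℂ)
          * Omega0 s (Tmap^[j] x)) L ∧
      Summable (fun j : ℕ =>
        ‖Complex.exp (Real.pi * Complex.I / 4
            * ((∑ ℓ ∈ Finset.range j, Real.sign (Tmap^[ℓ] x) : ℝ) : ℂ))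
          * (((∏ ℓ ∈ Finset.range j, |Tmap^[ℓ] x|) ^ (s - 1 / 2) : ℝ) : ℂ)
          * Omega0 s (Tmap^[j] x)‖) := by
  have hs : 0 < s := by linarith
  have hx1 : |x| ≤ 1 := abs_le.2 ⟨hx.1.le, hx.2.le⟩
  have hsm := Summable.of_norm_bounded (hsum.mul_left (renormConst s)) fun j =>
    (norm_norm (orbitCoeff s x j * Omega0 s (Tmap^[j] x))).trans_le
      (norm_orbitCoeff_mul_Omega0_le hs hs2 hx1 hirr j)
  exact ⟨_, tendsto_Fpart hs hs2 hx1 hirr hsum, hsm.of_norm.hasSum, hsm⟩
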